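/- For every integer p ≥ 0 there exists a constant C_p > 0, depending only on p, with the following property: for every b > 0, every Dirac potential Q on [0,b] with (p+1)-times continuously differentiable entries, and every transmutation kernel K for Q which is (p+1)-times continuously differentiable on Ω⁺, setting M := max_{(x,t) ∈ Ω⁺} |∂ₜ^{p+1}K(x,t)|, one has for every integer N > p+1 and every x ∈ (0,b]: (a) if λ ∈ ℝ then |U(λ,x) − U^N(λ,x)| ≤ 2·C_p·M·x^{p+2}/N^{p+1/2}; (b) if λ ∈ ℂ with Im λ ≠ 0 then |U(λ,x) − U^N(λ,x)| ≤ 2·C_p·M·(x^{p+1}/N^{p+1/2})·(e^{|Im λ|·x} − 1)/|Im λ|. -/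

import Mathlib

noncomputable section

open MeasureTheory Set Filter Topology Polynomial intervalIntegral

abbrev M2 : Type := Matrix (Fin 2) (Fin 2) ℂ

attribute [local instance] Matrix.normedAddCommGroup Matrix.normedSpace

/-- The matrix `B` of the Dirac system. -/
def Bmat : M2 := !![0, 1; -1, 0]

/-- The Dirac potential built from the scalar functions `p, q`. -/
def diracPot (p q : ℝ → ℂ) : ℝ → M2 := fun x => !![p x, q x; q x, -p x]

/-- Operator norm of a `2 × 2` complex matrix, induced by the Euclidean norm on `ℂ²`. -/
def opNorm (A : M2) : ℝ := ‖Matrix.toEuclideanCLM (𝕜 := ℂ) A‖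

/-- The Legendre polynomial of degree `n` (Rodrigues' formula). -/
def legendreP (n : ℕ) : Polynomial ℝ :=
  ((2 ^ n * n.factorial : ℝ)⁻¹) • (fun r => derivative r)^[n] ((X ^ 2 - 1 : Polynomial ℝ) ^ n)

/-- The domain `Ω⁺ = {(x,t) : 0 ≤ x ≤ b, |t| ≤ x}`. -/
def OmegaPlus (b : ℝ) : Set (ℝ × ℝ) := {z | 0 ≤ z.1 ∧ z.1 ≤ b ∧ |z.2| ≤ z.1}

/-- `K` is a transmutation kernel for the potential `Q` on `Ω⁺`: it satisfies the
hyperbolic PDE `B⬝∂ₓK + ∂ₜK⬝B = -Q⬝K` together with the two Goursat conditions. -/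
def IsTransKernel (b : ℝ) (Q : ℝ → M2) (K : ℝ → ℝ → M2) : Prop :=
  (∀ x t : ℝ, (x, t) ∈ OmegaPlus b →
      Bmat * deriv (fun s => K s t) x + deriv (fun s => K x s) t * Bmat = -(Q x * K x t)) ∧
  (∀ x ∈ Set.Icc (0 : ℝ) b, Bmat * K x x - K x x * Bmat = -Q x) ∧
  (∀ x ∈ Set.Icc (0 : ℝ) b, Bmat * K x (-x) + K x (-x) * Bmat = 0)

/-- The `n`-th Fourier–Legendre coefficient `K_n(x)` of the kernel `K`. -/
def Kcoef (K : ℝ → ℝ → M2) (n : ℕ) (x : ℝ) : M2 :=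
  ((2 * (n : ℝ) + 1) / 2) • ∫ t in (-x)..x, ((legendreP n).eval (t / x)) • K x t

/-- The truncated kernel `K^N(x,t) = Σ_{n=0}^{N} (1/x)·K_n(x)·P_n(t/x)`. -/
def KN (K : ℝ → ℝ → M2) (N : ℕ) (x t : ℝ) : M2 :=
  ∑ n ∈ Finset.range (N + 1), (x⁻¹ * (legendreP n).eval (t / x)) • Kcoef K n x

/-- The free solution `U₀(λ,x)`. -/
def U0 (lam : ℂ) (x : ℝ) : M2 :=
  !![Complex.cos (lam * x), -Complex.sin (lam * x);
     Complex.sin (lam * x), Complex.cos (lam * x)]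

/-- `U(λ,x) = U₀(λ,x) + ∫_{-x}^{x} K(x,t)·U₀(λ,t) dt`. -/
def Umat (K : ℝ → ℝ → M2) (lam : ℂ) (x : ℝ) : M2 :=
  U0 lam x + ∫ t in (-x)..x, K x t * U0 lam t

/-- `U^N(λ,x) = U₀(λ,x) + ∫_{-x}^{x} K^N(x,t)·U₀(λ,t) dt`. -/
def UmatN (K : ℝ → ℝ → M2) (N : ℕ) (lam : ℂ) (x : ℝ) : M2 :=
  U0 lam x + ∫ t in (-x)..x, KN K N x t * U0 lam t

/-- `θ_n(x) = xⁿ·K_n(x)` for `n ≥ 0`, and `θ_{-1}(x) = -K₀(x)/x`. -/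
def theta (K : ℝ → ℝ → M2) (n : ℤ) : ℝ → M2 := fun x =>
  if n = -1 then -(x⁻¹ • Kcoef K 0 x) else (x ^ n.toNat : ℝ) • Kcoef K n.toNat x

/-- The integral operator `S[H](x) = U(x)·∫₀ˣ U(t)⁻¹·Bᵀ·H(t) dt`, where `U = U(0,·)`. -/
def Sop (U : ℝ → M2) (H : ℝ → M2) (x : ℝ) : M2 :=
  U x * ∫ t in (0 : ℝ)..x, (U t)⁻¹ * Bmat.transpose * H t


/-- Integration of a polynomial over `[-1,1]`. -/
def Ip (F : ℝ[X]) : ℝ := ∫ t in (-1 : ℝ)..1, F.eval t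

lemma poly_ii (F : ℝ[X]) (a b : ℝ) : IntervalIntegrable (fun t => F.eval t) volume a b :=
  F.continuous.intervalIntegrable a b

lemma Ip_add (F G : ℝ[X]) : Ip (F + G) = Ip F + Ip G := by
  unfold Ip
  rw [← intervalIntegral.integral_add (poly_ii _ _ _) (poly_ii _ _ _)]
  simp

lemma Ip_sub (F G : ℝ[X]) : Ip (F - G) = Ip F - Ip G := by
  unfold Ip
  rw [← intervalIntegral.integral_sub (poly_ii _ _ _) (poly_ii _ _ _)]
  simp

lemma Ip_C_mul (c : ℝ) (F : ℝ[X]) : Ip (C c * F) = c * Ip F := by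
  unfold Ip
  rw [← intervalIntegral.integral_const_mul]
  simp

lemma Ip_zero : Ip 0 = 0 := by simp [Ip]

lemma Ip_sum {ι : Type*} (s : Finset ι) (f : ι → ℝ[X]) :
    Ip (∑ i ∈ s, f i) = ∑ i ∈ s, Ip (f i) := by
  classical
  induction s using Finset.induction_on with
  | empty => simp [Ip_zero]
  | insert a s ha ih => rw [Finset.sum_insert ha, Finset.sum_insert ha, Ip_add, ih]

lemma Ip_derivative (F : ℝ[X]) : Ip (derivative F) = F.eval 1 - F.eval (-1) := by
  unfold Ip
  exact intervalIntegral.integral_eq_sub_of_hasDerivAt (fun x _ => F.hasDerivAt x) (poly_ii _ _ _)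

lemma Ip_mono {F G : ℝ[X]} (h : ∀ t ∈ Icc (-1 : ℝ) 1, F.eval t ≤ G.eval t) : Ip F ≤ Ip G :=
  intervalIntegral.integral_mono_on (by norm_num) (poly_ii _ _ _) (poly_ii _ _ _) h

lemma Ip_sq_nonneg (F : ℝ[X]) : 0 ≤ Ip (F * F) := by
  rw [← Ip_zero]
  apply Ip_mono
  intro t _
  simp [mul_self_nonneg]

lemma C_two : (C (2 : ℝ) : ℝ[X]) = 2 := rfl

lemma legP_ode_aux (n m : ℕ) :
    (X ^ 2 - 1 : ℝ[X]) * derivative^[m + 2] ((X ^ 2 - 1 : ℝ[X]) ^ n)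
      + C (2 * (m + 1 : ℝ) - 2 * n) * X * derivative^[m + 1] ((X ^ 2 - 1 : ℝ[X]) ^ n)
      + C ((m + 1 : ℝ) * m - 2 * n * (m + 1)) * derivative^[m] ((X ^ 2 - 1 : ℝ[X]) ^ n) = 0 := by
  induction m with
  | zero =>
    have h : (X ^ 2 - 1 : ℝ[X]) * derivative ((X ^ 2 - 1 : ℝ[X]) ^ n)
        = C (2 * n : ℝ) * X * (X ^ 2 - 1 : ℝ[X]) ^ n := by
      rcases n with _ | n
      · simp
      · rw [derivative_pow]
        simp [C_two]
        ring
    have h2 := congrArg derivative h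
    simp only [derivative_mul, derivative_C, derivative_X, derivative_sub, derivative_X_pow,
      derivative_one] at h2
    simp only [Function.iterate_succ, Function.iterate_zero, Function.comp, id]
    simp [C_two] at h2 ⊢
    linear_combination h2
  | succ m ih =>
    have h2 := congrArg derivative ih
    simp only [derivative_mul, derivative_C, derivative_X, derivative_sub, derivative_X_pow,
      derivative_one, derivative_add, derivative_zero, ← Function.iterate_succ_apply'] at h2
    simp [C_two] at h2 ⊢
    linear_combination h2

lemma legP_def (n : ℕ) : legendreP n = C ((2 ^ n * n.factorial : ℝ)⁻¹) *
    derivative^[n] ((X ^ 2 - 1 : ℝ[X]) ^ n) := by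
  rw [← smul_eq_C_mul]; rfl

lemma legP_ode (n : ℕ) : (X ^ 2 - 1 : ℝ[X]) * derivative (derivative (legendreP n))
    + 2 * X * derivative (legendreP n) = C ((n : ℝ) * (n + 1)) * legendreP n := by
  have h := legP_ode_aux n n
  rw [legP_def]
  simp only [derivative_C_mul, ← Function.iterate_succ_apply']
  simp [C_two] at h ⊢
  linear_combination (C (n.factorial : ℝ)⁻¹ * C (2 ^ n : ℝ)⁻¹) * h

lemma legP_ode' (n : ℕ) : derivative ((X ^ 2 - 1 : ℝ[X]) * derivative (legendreP n))
    = C ((n : ℝ) * (n + 1)) * legendreP n := by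
  rw [← legP_ode]
  simp
  ring

lemma legP_eval_aux (n : ℕ) (r : ℝ) (hr : r ^ 2 = 1) : (legendreP n).eval r = r ^ n := by
  have h : (derivative^[n] ((X ^ 2 - 1 : ℝ[X]) ^ n)).eval r = n.factorial * (2 * r) ^ n := by
    rw [← factorial_smul_hasseDeriv]
    have : ((hasseDeriv n) ((X ^ 2 - 1 : ℝ[X]) ^ n)).eval r = (2 * r) ^ n := by
      rw [← taylor_coeff]
      have e : taylor r ((X ^ 2 - 1 : ℝ[X]) ^ n) = (X + C (2 * r)) ^ n * X ^ n := by
        rw [taylor_apply]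
        simp only [pow_comp, sub_comp, X_comp, one_comp]
        rw [← mul_pow]
        congr 1
        have : (C (r ^ 2) : ℝ[X]) = 1 := by rw [hr]; simp
        rw [C_pow] at this
        simp only [C_mul, C_two]
        linear_combination this
      rw [e]
      have := coeff_mul_X_pow ((X + C (2 * r) : ℝ[X]) ^ n) n 0
      rw [zero_add] at this
      rw [this, coeff_zero_eq_eval_zero]
      simp
    simp [this]
  rw [legP_def]
  simp only [eval_mul, eval_C, h]
  have : (n.factorial : ℝ) ≠ 0 := by positivity
  field_simp
  ring

lemma legP_zero : legendreP 0 = 1 := by simp [legP_def]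

lemma legP_natDegree_le (n : ℕ) : (legendreP n).natDegree ≤ n := by
  rw [legP_def]
  refine (natDegree_C_mul_le _ _).trans ?_
  refine (natDegree_iterate_derivative _ _).trans ?_
  have : ((X ^ 2 - 1 : ℝ[X]) ^ n).natDegree ≤ n * 2 := by
    refine natDegree_pow_le.trans ?_
    gcongr
    compute_degree
  omega

/-- The Legendre operator is self-adjoint against Legendre polynomials. -/
lemma Ip_L (F G : ℝ[X]) : Ip (derivative ((X ^ 2 - 1) * derivative F) * G)
    = - Ip ((X ^ 2 - 1) * derivative F * derivative G) := by
  have h := Ip_derivative ((X ^ 2 - 1) * derivative F * G)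
  rw [derivative_mul, Ip_add] at h
  simp at h
  rw [derivative_mul] 
  simp
  linarith

lemma Ip_L_symm (F G : ℝ[X]) : Ip (derivative ((X ^ 2 - 1) * derivative F) * G)
    = Ip (F * derivative ((X ^ 2 - 1) * derivative G)) := by
  rw [Ip_L, mul_comm F, Ip_L]
  congr 2; ring

lemma legP_orth_X (n : ℕ) (m : ℕ) (hm : m < n) : Ip (legendreP n * X ^ m) = 0 := by
  induction m using Nat.strong_induction_on with
  | _ m ih =>
    have h := Ip_L_symm (legendreP n) (X ^ m)
    rw [legP_ode'] at h
    have e : derivative ((X ^ 2 - 1 : ℝ[X]) * derivative (X ^ m)) =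
        C ((m : ℝ) * (m + 1)) * X ^ m - C ((m : ℝ) * (m - 1)) * X ^ (m - 2) := by
      rcases m with _ | _ | m
      · simp
      · simp
      · simp; ring
    have h0 : (m : ℝ) * (m - 1) * Ip (legendreP n * X ^ (m - 2)) = 0 := by
      rcases m with _ | _ | m
      · simp
      · simp
      · rw [ih (m + 2 - 2) (by omega) (by omega)]; simp
    rw [e, mul_sub, Ip_sub, mul_assoc, Ip_C_mul, mul_left_comm, Ip_C_mul, mul_left_comm, Ip_C_mul,
      h0] at h
    have h2 : ((n : ℝ) * (n + 1) - m * (m + 1)) * Ip (legendreP n * X ^ m) = 0 := by linarith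
    have h3 : (m : ℝ) < n := by exact_mod_cast hm
    have h4 : ((n : ℝ) * (n + 1) - m * (m + 1)) ≠ 0 := by
      have : (0 : ℝ) ≤ m := by positivity
      nlinarith
    exact (mul_eq_zero.mp h2).resolve_left h4

lemma legP_orth (n : ℕ) (q : ℝ[X]) (hq : q.natDegree < n) : Ip (legendreP n * q) = 0 := by
  rw [q.as_sum_range_C_mul_X_pow, Finset.mul_sum, Ip_sum]
  apply Finset.sum_eq_zero
  intro i hi
  rw [mul_left_comm, Ip_C_mul, legP_orth_X n i (by simp at hi; omega), mul_zero]

lemma legP_orth_ne (n m : ℕ) (h : n ≠ m) : Ip (legendreP n * legendreP m) = 0 := by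
  rcases lt_or_gt_of_ne h with h | h
  · rw [mul_comm]
    exact legP_orth m _ ((legP_natDegree_le n).trans_lt h)
  · exact legP_orth n _ ((legP_natDegree_le m).trans_lt h)

lemma legP_norm (n : ℕ) : Ip (legendreP n * legendreP n) = 2 / (2 * n + 1) := by
  have h := Ip_derivative (X * legendreP n * legendreP n)
  have h1 : Ip (legendreP n * (X * derivative (legendreP n) - C (n : ℝ) * legendreP n)) = 0 := by
    rcases Nat.eq_zero_or_pos n with rfl | hn
    · simp [legP_zero, Ip_zero]
    apply legP_orth
    have hd : (X * derivative (legendreP n) - C (n : ℝ) * legendreP n).natDegree ≤ n - 1 := by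
      rw [natDegree_le_iff_coeff_eq_zero]
      intro k hk
      obtain ⟨k, rfl⟩ : ∃ j, k = j + 1 := ⟨k - 1, by omega⟩
      rw [coeff_sub, coeff_X_mul, coeff_derivative, coeff_C_mul]
      rcases eq_or_ne (k + 1) n with h | h
      · rw [← h]; push_cast; ring
      · rw [coeff_eq_zero_of_natDegree_lt ((legP_natDegree_le n).trans_lt (by omega))]
        simp
    omega
  have e : derivative (X * legendreP n * legendreP n) = C (2 : ℝ) * (legendreP n *
      (X * derivative (legendreP n) - C (n : ℝ) * legendreP n)) +
      C (2 * n + 1 : ℝ) * (legendreP n * legendreP n) := by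
    simp [C_two]; ring
  rw [e, Ip_add, Ip_C_mul, Ip_C_mul, h1] at h
  simp only [eval_mul, eval_X, legP_eval_aux n 1 (by norm_num),
    legP_eval_aux n (-1) (by norm_num)] at h
  have : ((-1 : ℝ)) ^ n * (-1) ^ n = 1 := by rw [← mul_pow]; simp
  have h3 : (2 * n + 1 : ℝ) * Ip (legendreP n * legendreP n) = 2 := by
    simp at h
    linarith
  field_simp
  linarith

lemma legP_coeff_ne (n : ℕ) : (legendreP n).coeff n ≠ 0 := by
  intro h
  have h2 := legP_norm n
  have hpos : (2 : ℝ) / (2 * n + 1) ≠ 0 := by positivity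
  rcases Nat.eq_zero_or_pos n with rfl | hn
  · simp [legP_zero] at h
  rw [legP_orth n] at h2
  · exact hpos h2.symm
  · have : (legendreP n).natDegree ≤ n - 1 := by
      rw [natDegree_le_iff_coeff_eq_zero]
      intro k hk
      rcases eq_or_ne k n with rfl | h'
      · exact h
      · exact coeff_eq_zero_of_natDegree_lt ((legP_natDegree_le n).trans_lt (by omega))
    omega

/-- sup bound for Legendre polynomials -/
lemma legP_abs_le (n : ℕ) (t : ℝ) (ht : t ∈ Icc (-1 : ℝ) 1) : |(legendreP n).eval t| ≤ 1 := by
  rcases Nat.eq_zero_or_pos n with rfl | hn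
  · simp [legP_zero]
  set P := legendreP n with hP
  set E : ℝ[X] := C ((n : ℝ) * (n + 1)) * P ^ 2 + (1 - X ^ 2) * derivative P ^ 2 with hE
  have hd : derivative E = 2 * X * derivative P ^ 2 := by
    have := legP_ode n
    rw [← hP] at this
    rw [hE]
    simp only [derivative_add, derivative_mul, derivative_C, derivative_pow, derivative_sub,
      derivative_one, derivative_X]
    simp [C_two]
    simp at this
    linear_combination (-2 * derivative P) * this
  have hn0 : (0 : ℝ) < (n : ℝ) * (n + 1) := by positivity
  have hle : E.eval t ≤ (n : ℝ) * (n + 1) := by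
    rcases le_total 0 t with h0 | h0
    · have hm : MonotoneOn (fun s => E.eval s) (Icc 0 1) := by
        apply monotoneOn_of_deriv_nonneg (convex_Icc 0 1) E.continuous.continuousOn
          E.differentiable.differentiableOn
        intro s hs
        rw [interior_Icc] at hs
        rw [Polynomial.deriv, hd]
        simp
        have := hs.1
        positivity
      have := hm ⟨h0, ht.2⟩ (right_mem_Icc.mpr zero_le_one) ht.2
      refine this.trans (le_of_eq ?_)
      simp [hE, hP, legP_eval_aux n 1 (by norm_num)]
    · have hm : AntitoneOn (fun s => E.eval s) (Icc (-1) 0) := by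
        apply antitoneOn_of_deriv_nonpos (convex_Icc (-1) 0) E.continuous.continuousOn
          E.differentiable.differentiableOn
        intro s hs
        rw [interior_Icc] at hs
        rw [Polynomial.deriv, hd]
        simp
        have := hs.2
        exact mul_nonpos_of_nonpos_of_nonneg (by linarith) (sq_nonneg _)
      have := hm (left_mem_Icc.mpr (by norm_num)) ⟨ht.1, h0⟩ ht.1
      refine this.trans (le_of_eq ?_)
      simp [hE, hP, legP_eval_aux n (-1) (by norm_num), ← pow_mul]
  have h1 : (n : ℝ) * (n + 1) * P.eval t ^ 2 ≤ E.eval t := by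
    rw [hE]
    simp
    have : t ^ 2 ≤ 1 := by nlinarith [ht.1, ht.2]
    exact mul_nonneg (by linarith) (sq_nonneg _)
  have h2 : P.eval t ^ 2 ≤ 1 := by
    by_contra hc
    push Not at hc
    nlinarith
  exact abs_le_one_iff_mul_self_le_one.mpr (by nlinarith)

/-- Legendre coefficient of a polynomial -/
def lc (n : ℕ) (F : ℝ[X]) : ℝ := (2 * (n : ℝ) + 1) / 2 * Ip (legendreP n * F)

/-- Legendre partial sum of a polynomial -/
def Sp (N : ℕ) (F : ℝ[X]) : ℝ[X] := ∑ n ∈ Finset.range (N + 1), C (lc n F) * legendreP n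

/-- remainder -/
def Tp (N : ℕ) (F : ℝ[X]) : ℝ[X] := F - Sp N F

lemma lc_add (n : ℕ) (F G : ℝ[X]) : lc n (F + G) = lc n F + lc n G := by
  simp only [lc, mul_add, Ip_add]

lemma lc_C_mul (n : ℕ) (c : ℝ) (F : ℝ[X]) : lc n (C c * F) = c * lc n F := by
  simp only [lc]; rw [mul_left_comm, Ip_C_mul]; ring

lemma lc_leg (n m : ℕ) : lc n (legendreP m) = if n = m then 1 else 0 := by
  unfold lc
  split_ifs with h
  · subst h; rw [legP_norm]; field_simp
  · rw [legP_orth_ne n m h, mul_zero]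

lemma Ip_eq_lc (n : ℕ) (F : ℝ[X]) : Ip (legendreP n * F) = 2 / (2 * n + 1) * lc n F := by
  unfold lc; field_simp

lemma Tp_add (N : ℕ) (F G : ℝ[X]) : Tp N (F + G) = Tp N F + Tp N G := by
  simp only [Tp, Sp, lc_add, C_add, add_mul, Finset.sum_add_distrib]; ring

lemma Tp_C_mul (N : ℕ) (c : ℝ) (F : ℝ[X]) : Tp N (C c * F) = C c * Tp N F := by
  simp only [Tp, Sp, lc_C_mul, C_mul, mul_sub, Finset.mul_sum, mul_assoc]

lemma Tp_sub (N : ℕ) (F G : ℝ[X]) : Tp N (F - G) = Tp N F - Tp N G := by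
  have := Tp_add N F (C (-1) * G)
  rw [Tp_C_mul] at this
  simp only [C_neg, C_1, neg_mul, one_mul, ← sub_eq_add_neg] at this
  exact this

lemma Tp_leg (N m : ℕ) (h : m ≤ N) : Tp N (legendreP m) = 0 := by
  unfold Tp Sp
  rw [Finset.sum_eq_single m]
  · simp [lc_leg]
  · intro b _ hb; simp [lc_leg, hb]
  · intro h'; simp at h'; omega

lemma Tp_of_degree (N d : ℕ) (hd : d ≤ N) (q : ℝ[X]) (hq : q.natDegree ≤ d) : Tp N q = 0 := by
  induction d generalizing q with
  | zero =>
    rw [eq_C_of_natDegree_le_zero hq]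
    have := Tp_C_mul N (q.coeff 0) (legendreP 0)
    rw [Tp_leg N 0 (by omega)] at this
    simpa [legP_zero] using this
  | succ d ih =>
    set c := q.coeff (d + 1) / (legendreP (d + 1)).coeff (d + 1) with hc
    have h1 : Tp N (q - C c * legendreP (d + 1)) = 0 := by
      apply ih (by omega)
      rw [natDegree_le_iff_coeff_eq_zero]
      intro k hk
      rw [coeff_sub, coeff_C_mul]
      rcases eq_or_ne k (d + 1) with rfl | h'
      · rw [hc, div_mul_cancel₀ _ (legP_coeff_ne _), sub_self]
      · rw [coeff_eq_zero_of_natDegree_lt ((legP_natDegree_le _).trans_lt (by omega)),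
          coeff_eq_zero_of_natDegree_lt (hq.trans_lt (by omega))]
        simp
    rw [Tp_sub, Tp_C_mul, Tp_leg N (d + 1) hd] at h1
    simpa using h1

lemma Sp_of_degree (N : ℕ) (q : ℝ[X]) (hq : q.natDegree ≤ N) : Sp N q = q := by
  have := Tp_of_degree N N le_rfl q hq
  unfold Tp at this
  exact (sub_eq_zero.mp this).symm

lemma Ip_Sp_mul (N : ℕ) (F G : ℝ[X]) :
    Ip (Sp N F * G) = ∑ n ∈ Finset.range (N + 1), lc n F * lc n G * (2 / (2 * n + 1)) := by
  unfold Sp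
  rw [Finset.sum_mul, Ip_sum]
  apply Finset.sum_congr rfl
  intro n _
  rw [mul_assoc, Ip_C_mul, Ip_eq_lc]
  ring

lemma Ip_Tp_orth (N : ℕ) (F q : ℝ[X]) (hq : q.natDegree ≤ N) : Ip (Tp N F * q) = 0 := by
  have h1 := Ip_Sp_mul N F q
  have h2 := Ip_Sp_mul N q F
  rw [Sp_of_degree N q hq] at h2
  unfold Tp
  rw [sub_mul, Ip_sub, h1, mul_comm F q, h2, sub_eq_zero]
  apply Finset.sum_congr rfl
  intros; ring

lemma Sp_natDegree (N : ℕ) (F : ℝ[X]) : (Sp N F).natDegree ≤ N := by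
  unfold Sp
  apply natDegree_sum_le_of_forall_le
  intro n hn
  exact (natDegree_C_mul_le _ _).trans ((legP_natDegree_le n).trans (by simp at hn; omega))

lemma Ip_Tp_sq (N : ℕ) (F : ℝ[X]) : Ip (Tp N F * Tp N F) = Ip (F * F) - Ip (Sp N F * F) := by
  have : Tp N F * Tp N F = F * F - Sp N F * F - Tp N F * Sp N F := by unfold Tp; ring
  rw [this, Ip_sub, Ip_Tp_orth N F _ (Sp_natDegree N F), Ip_sub, sub_zero]

lemma Tp_base (N : ℕ) (F : ℝ[X]) :
    Ip (Tp N F * Tp N F) * ((N : ℝ) + 1) ^ 2 ≤ Ip (derivative F * derivative F) := by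
  set d := N + F.natDegree with hd
  have hF : Sp d F = F := Sp_of_degree d F (by omega)
  have h1 : Ip (F * F) = ∑ n ∈ Finset.range (d + 1), lc n F * lc n F * (2 / (2 * n + 1)) := by
    have := Ip_Sp_mul d F F
    rwa [hF] at this
  have h2 : Ip ((1 - X ^ 2) * derivative F * derivative F) =
      ∑ n ∈ Finset.range (d + 1), (n : ℝ) * (n + 1) * (lc n F * lc n F * (2 / (2 * n + 1))) := by
    have e : Ip ((1 - X ^ 2) * derivative F * derivative F) =
        Ip (F * derivative ((X ^ 2 - 1) * derivative F)) := by
      rw [mul_comm F, Ip_L]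
      have : (1 - X ^ 2) * derivative F * derivative F =
        C (-1) * ((X ^ 2 - 1) * derivative F * derivative F) := by simp; ring
      rw [this, Ip_C_mul]; ring
    rw [e]
    conv_lhs => rw [← hF]
    rw [Ip_Sp_mul]
    apply Finset.sum_congr rfl
    intro n _
    have : lc n (derivative ((X ^ 2 - 1) * derivative (Sp d F))) = (n : ℝ) * (n + 1) * lc n F := by
      rw [hF]
      unfold lc
      rw [← Ip_L_symm, legP_ode', mul_assoc, Ip_C_mul]; ring
    rw [this]; ring
  have h3 : Ip ((1 - X ^ 2) * derivative F * derivative F) ≤ Ip (derivative F * derivative F) := by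
    apply Ip_mono
    intro t ht
    simp
    have := mul_nonneg (sq_nonneg t) (mul_self_nonneg (eval t (derivative F)))
    nlinarith
  refine le_trans ?_ h3
  rw [Ip_Tp_sq, h1, h2, Ip_Sp_mul, hd, Finset.range_eq_Ico, Finset.range_eq_Ico]
  rw [← Finset.sum_Ico_consecutive _ (Nat.zero_le (N + 1)) (show N + 1 ≤ N + F.natDegree + 1 by omega),
    add_sub_cancel_left,
    ← Finset.sum_Ico_consecutive _ (Nat.zero_le (N + 1)) (show N + 1 ≤ N + F.natDegree + 1 by omega)]
  refine le_trans ?_ (le_add_of_nonneg_left ?_)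
  · rw [Finset.sum_mul]
    apply Finset.sum_le_sum
    intro n hn
    rw [mul_comm]
    have h : (N : ℝ) + 1 ≤ n := by simp at hn; exact_mod_cast hn.1
    have h0 : (0 : ℝ) ≤ N := by positivity
    have := mul_self_nonneg (lc n F)
    gcongr
    nlinarith
  · apply Finset.sum_nonneg
    intro n _
    have := mul_self_nonneg (lc n F)
    positivity

lemma exists_anti (F : ℝ[X]) (c : ℝ) : ∃ G : ℝ[X], derivative G = F ∧
    G.natDegree ≤ F.natDegree + 1 ∧ G.eval (-1) = c := by
  set G0 : ℝ[X] := ∑ i ∈ Finset.range (F.natDegree + 1), C (F.coeff i / (i + 1)) * X ^ (i + 1)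
    with hG0
  refine ⟨G0 + C (c - G0.eval (-1)), ?_, ?_, by simp⟩
  · rw [derivative_add, derivative_C, add_zero, hG0, derivative_sum]
    conv_rhs => rw [F.as_sum_range_C_mul_X_pow]
    apply Finset.sum_congr rfl
    intro i _
    rw [derivative_C_mul, derivative_X_pow]
    simp only [← mul_assoc, ← C_mul, Nat.add_sub_cancel]
    congr 2
    push_cast
    field_simp
  · rw [natDegree_add_C]
    apply natDegree_sum_le_of_forall_le
    intro i hi
    exact (natDegree_C_mul_X_pow_le _ _).trans (by simp at hi; omega)

lemma Tp_step (N : ℕ) (F : ℝ[X]) :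
    Ip (Tp (N + 1) F * Tp (N + 1) F) * ((N : ℝ) + 2) ^ 2 ≤
      Ip (Tp N (derivative F) * Tp N (derivative F)) := by
  obtain ⟨q, hq, hqd, -⟩ := exists_anti (Sp N (derivative F)) 0
  have h1 : Tp (N + 1) (F - q) = Tp (N + 1) F := by
    rw [Tp_sub, Tp_of_degree (N + 1) (N + 1) le_rfl q, sub_zero]
    have := Sp_natDegree N (derivative F)
    omega
  have h2 := Tp_base (N + 1) (F - q)
  rw [h1, derivative_sub, hq] at h2
  push_cast at h2
  refine le_trans (le_of_eq ?_) h2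
  ring

lemma Ip_Tp_le (N : ℕ) (F : ℝ[X]) : Ip (Tp N F * Tp N F) ≤ Ip (F * F) := by
  rw [Ip_Tp_sq, Ip_Sp_mul]
  have : 0 ≤ ∑ n ∈ Finset.range (N + 1), lc n F * lc n F * (2 / (2 * (n : ℝ) + 1)) := by
    apply Finset.sum_nonneg
    intro n _
    have := mul_self_nonneg (lc n F)
    positivity
  linarith

lemma Tp_iter (k : ℕ) : ∀ (N : ℕ) (D : ℝ) (F : ℝ[X]), 0 < D → D + k ≤ (N : ℝ) + 2 → 1 ≤ D →
    Ip (Tp N F * Tp N F) * (D ^ k) ^ 2 ≤ Ip (derivative^[k] F * derivative^[k] F) := by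
  induction k with
  | zero =>
    intro N D F _ _ _
    simpa using Ip_Tp_le N F
  | succ k ih =>
    intro N D F hD hk h1
    push_cast at hk
    rcases N with _ | N
    · have hk0 : k = 0 := by
        by_contra h
        have : (1 : ℝ) ≤ k := by exact_mod_cast Nat.one_le_iff_ne_zero.mpr h
        push_cast at hk
        linarith
      subst hk0
      have := Tp_base 0 F
      have hD1 : D = 1 := by push_cast at hk; linarith
      subst hD1
      simpa using this
    · push_cast at hk
      have h2 := ih N D (derivative F) hD (by linarith) h1
      have h3 := Tp_step N F
      rw [Function.iterate_succ_apply]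
      refine le_trans ?_ h2
      have hN : D ≤ (N : ℝ) + 2 := by have : (0 : ℝ) ≤ k := by positivity
                                      linarith
      have h4 := Ip_sq_nonneg (Tp (N + 1) F)
      have h5 : D ^ 2 ≤ ((N : ℝ) + 2) ^ 2 := pow_le_pow_left₀ hD.le hN 2
      have h6 := (mul_le_mul_of_nonneg_left h5 h4).trans h3
      refine le_trans (le_of_eq ?_) (mul_le_mul_of_nonneg_right h6 (sq_nonneg (D ^ k)))
      ring

lemma Ip_sq_le_of_abs (F : ℝ[X]) (m : ℝ) (h : ∀ t ∈ Icc (-1 : ℝ) 1, |F.eval t| ≤ m) :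
    Ip (F * F) ≤ 2 * m ^ 2 := by
  have : Ip (F * F) ≤ Ip (C (m ^ 2)) := by
    apply Ip_mono
    intro t ht
    have := h t ht
    simp
    rw [← sq, ← sq_abs]
    gcongr
  refine this.trans (le_of_eq ?_)
  simp [Ip]; norm_num

lemma Tp_decomp (k N : ℕ) (D : ℝ) (hD : 1 ≤ D) (hk : D + (k + 1 : ℕ) ≤ (N : ℝ) + 2)
    (F : ℝ[X]) (m : ℝ) (hm : ∀ t ∈ Icc (-1 : ℝ) 1, |(derivative^[k + 1] F).eval t| ≤ m) :
    ∃ (H : ℝ[X]) (α β : ℝ), Tp N F = H + C α * legendreP (N + 1) + C β * legendreP (N + 2) ∧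
      H.eval 1 = 0 ∧ H.eval (-1) = 0 ∧
      Ip (derivative H * derivative H) * (D ^ k) ^ 2 ≤ 2 * m ^ 2 ∧
      α ^ 2 * (D ^ (k + 1)) ^ 2 ≤ 8 * (N + 3) * m ^ 2 ∧
      β ^ 2 * (D ^ (k + 1)) ^ 2 ≤ 8 * (N + 3) * m ^ 2 := by
  obtain ⟨H, hH, -, hH1⟩ := exists_anti (Tp (N + 1) (derivative F)) 0
  have hHr : H.eval 1 = 0 := by
    have := Ip_derivative H
    rw [hH, hH1] at this
    have h2 := Ip_Tp_orth (N + 1) (derivative F) 1 (by simp)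
    rw [mul_one] at h2
    linarith
  have hHT : Tp N H = H := by
    unfold Tp
    rw [sub_eq_self]
    unfold Sp
    apply Finset.sum_eq_zero
    intro n hn
    obtain ⟨Φ, hΦ, hΦd, -⟩ := exists_anti (legendreP n) 0
    have h1 := Ip_derivative (Φ * H)
    rw [derivative_mul, Ip_add, hΦ, hH, eval_mul, eval_mul, hHr, hH1, mul_comm Φ, Ip_Tp_orth] at h1
    · have : lc n H = 0 := by
        unfold lc
        rw [mul_eq_zero]; right; linarith
      rw [this]; simp
    · have := legP_natDegree_le n
      simp at hn
      omega
  -- the polynomial F - H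
  have hdeg : (F - H).natDegree ≤ N + 2 := by
    have hd : derivative (F - H) = Sp (N + 1) (derivative F) := by
      rw [derivative_sub, hH]; unfold Tp; ring
    obtain ⟨G, hG, hGd, hG1⟩ := exists_anti (Sp (N + 1) (derivative F)) 0
    have : derivative (F - H - G) = 0 := by rw [derivative_sub, hd, hG, sub_self]
    have h0 := derivative_eq_zero.mp this
    have h2 : F - H = (F - H - G) + G := by ring
    rw [h2]
    refine (natDegree_add_le _ _).trans ?_
    have := Sp_natDegree (N + 1) (derivative F)
    simp [h0]
    omega
  set W := F - H with hW
  set α := lc (N + 1) W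
  set β := lc (N + 2) W
  have hTW : Tp N W = C α * legendreP (N + 1) + C β * legendreP (N + 2) := by
    have h1 := Sp_of_degree (N + 2) W hdeg
    have h2 : Sp (N + 2) W = Sp N W + C α * legendreP (N + 1) + C β * legendreP (N + 2) := by
      unfold Sp
      rw [Finset.sum_range_succ, Finset.sum_range_succ]
    unfold Tp
    rw [← h2.symm.trans h1]
    have : Sp N (Sp N W + C α * legendreP (N + 1) + C β * legendreP (N + 2)) = Sp N W := by
      rw [← h2, h1]
    rw [this]; ring
  have hTF : Tp N F = H + Tp N W := by
    rw [hW, Tp_sub, hHT]; ring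
  have hdH : Ip (derivative H * derivative H) * (D ^ k) ^ 2 ≤ 2 * m ^ 2 := by
    rw [hH]
    have h1 := Tp_iter k (N + 1) D (derivative F) (by linarith) (by push_cast at hk ⊢; linarith) hD
    rw [← Function.iterate_succ_apply] at h1
    exact h1.trans (Ip_sq_le_of_abs _ _ hm)
  have hHH : Ip (H * H) * (D ^ (k + 1)) ^ 2 ≤ 2 * m ^ 2 := by
    have h1 := Tp_base N H
    rw [hHT] at h1
    refine le_trans ?_ hdH
    calc Ip (H * H) * (D ^ (k + 1)) ^ 2 = Ip (H * H) * D ^ 2 * (D ^ k) ^ 2 := by ring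
      _ ≤ Ip (H * H) * ((N : ℝ) + 1) ^ 2 * (D ^ k) ^ 2 := by
        have := Ip_sq_nonneg H
        have hk' : (0 : ℝ) ≤ k := by positivity
        push_cast at hk
        gcongr
        linarith
      _ ≤ _ := by gcongr
  have hFF : Ip (Tp N F * Tp N F) * (D ^ (k + 1)) ^ 2 ≤ 2 * m ^ 2 :=
    (Tp_iter (k + 1) N D F (by linarith) hk hD).trans (Ip_sq_le_of_abs _ _ hm)
  have hWW : Ip (Tp N W * Tp N W) ≤ 2 * Ip (H * H) + 2 * Ip (Tp N F * Tp N F) := by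
    have h1 : Tp N W = Tp N F - H := by rw [hTF]; ring
    have h2 := Ip_sq_nonneg (Tp N F + H)
    have h3 : Tp N W * Tp N W + (Tp N F + H) * (Tp N F + H)
        = C 2 * (H * H) + C 2 * (Tp N F * Tp N F) := by
      rw [h1, C_two]; ring
    have h4 := congrArg Ip h3
    rw [Ip_add, Ip_add, Ip_C_mul, Ip_C_mul] at h4
    linarith
  have hab : Ip (Tp N W * Tp N W) = α ^ 2 * (2 / (2 * (N + 1) + 1)) + β ^ 2 * (2 / (2 * (N + 2) + 1)) := by
    have h1 : Tp N W * Tp N W = C (α * α) * (legendreP (N + 1) * legendreP (N + 1))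
      + C (2 * α * β) * (legendreP (N + 1) * legendreP (N + 2))
      + C (β * β) * (legendreP (N + 2) * legendreP (N + 2)) := by
      rw [hTW]; simp only [C_mul, C_two]; ring
    rw [h1, Ip_add, Ip_add, Ip_C_mul, Ip_C_mul, Ip_C_mul, legP_norm, legP_norm,
      legP_orth_ne _ _ (by omega)]
    push_cast
    ring
  have hfin : (α ^ 2 * (2 / (2 * (N + 1) + 1)) + β ^ 2 * (2 / (2 * (N + 2) + 1))) * (D ^ (k + 1)) ^ 2
      ≤ 8 * m ^ 2 := by
    rw [← hab]
    have := mul_le_mul_of_nonneg_right hWW (sq_nonneg (D ^ (k + 1)))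
    linarith
  have key : ∀ c : ℝ, c ^ 2 * (1 / (N + 3)) ≤ α ^ 2 * (2 / (2 * (N + 1) + 1)) + β ^ 2 * (2 / (2 * (N + 2) + 1))
      → c ^ 2 * (D ^ (k + 1)) ^ 2 ≤ 8 * (N + 3) * m ^ 2 := by
    intro c hc
    have h1 := (mul_le_mul_of_nonneg_right hc (sq_nonneg (D ^ (k + 1)))).trans hfin
    have h2 : c ^ 2 * (D ^ (k + 1)) ^ 2 = (N + 3) * (c ^ 2 * (1 / (N + 3)) * (D ^ (k + 1)) ^ 2) := by
      field_simp
    rw [h2]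
    have : (0 : ℝ) ≤ N + 3 := by positivity
    nlinarith
  have e1 : (1 : ℝ) / (N + 3) ≤ 2 / (2 * (N + 1) + 1) := by
    rw [div_le_div_iff₀ (by positivity) (by positivity)]; linarith
  have e2 : (1 : ℝ) / (N + 3) ≤ 2 / (2 * (N + 2) + 1) := by
    rw [div_le_div_iff₀ (by positivity) (by positivity)]; linarith
  refine ⟨H, α, β, ?_, hHr, hH1, hdH, key α ?_, key β ?_⟩
  · rw [hTF, hTW]; ring
  · refine le_trans (mul_le_mul_of_nonneg_left e1 (sq_nonneg _)) (le_add_of_nonneg_right ?_)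
    positivity
  · refine le_trans (mul_le_mul_of_nonneg_left e2 (sq_nonneg _)) (le_add_of_nonneg_left ?_)
    positivity

/-- `∫_{-1}^1 e^{ρ t} dt` -/
def Jint (ρ : ℝ) : ℝ := ∫ t in (-1 : ℝ)..1, Real.exp (ρ * t)

lemma Jint_neg (ρ : ℝ) : Jint (-ρ) = Jint ρ := by
  unfold Jint
  have := intervalIntegral.integral_comp_neg (a := -1) (b := 1) (fun t => Real.exp (ρ * t))
  simp only [neg_neg] at this
  rw [← this]
  congr 1; ext t; congr 1; ring

lemma Jint_abs (ρ : ℝ) : Jint |ρ| = Jint ρ := by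
  rcases abs_choice ρ with h | h <;> rw [h]
  exact Jint_neg ρ

lemma Jint_eq (ρ : ℝ) (h : ρ ≠ 0) : Jint ρ = (Real.exp ρ - Real.exp (-ρ)) / ρ := by
  unfold Jint
  have : ∀ t ∈ uIcc (-1 : ℝ) 1, HasDerivAt (fun t => Real.exp (ρ * t) / ρ) (Real.exp (ρ * t)) t := by
    intro t _
    have h1 := (((hasDerivAt_id t).const_mul ρ).exp).div_const ρ
    simp only [id, mul_one] at h1
    rwa [mul_div_cancel_right₀ _ h] at h1
  rw [intervalIntegral.integral_eq_sub_of_hasDerivAt this]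
  · simp; ring
  · exact (by fun_prop : Continuous fun t => Real.exp (ρ * t)).intervalIntegrable _ _

lemma Jint_nonneg (ρ : ℝ) : 0 ≤ Jint ρ :=
  intervalIntegral.integral_nonneg (by norm_num) (fun _ _ => (Real.exp_pos _).le)

lemma Jint_zero : Jint 0 = 2 := by simp [Jint]; norm_num

lemma Jint_le (ρ : ℝ) (h : 0 < ρ) : Jint ρ ≤ 2 * ((Real.exp ρ - 1) / ρ) := by
  rw [Jint_eq ρ h.ne', ← mul_div_assoc]
  gcongr
  have h1 : Real.exp ρ * Real.exp (-ρ) = 1 := by rw [← Real.exp_add]; simp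
  have h2 := Real.exp_pos ρ
  nlinarith [sq_nonneg (Real.exp ρ - 1), Real.exp_pos (-ρ)]

lemma Jint_two (ρ : ℝ) : Jint (2 * ρ) ≤ Jint ρ ^ 2 * (1 + |ρ|) / 2 := by
  rw [← Jint_abs (2 * ρ), ← Jint_abs ρ, abs_mul, abs_two]
  rcases eq_or_ne ρ 0 with rfl | h
  · simp [Jint_zero]; norm_num
  have hp : 0 < |ρ| := abs_pos.mpr h
  generalize |ρ| = r at hp
  rw [Jint_eq _ hp.ne', Jint_eq _ (by positivity)]
  set E := Real.exp r
  set E' := Real.exp (-r)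
  have e1 : Real.exp (2 * r) = E ^ 2 := by rw [← Real.exp_nat_mul]; simp
  have e2 : Real.exp (-(2 * r)) = E' ^ 2 := by rw [← Real.exp_nat_mul]; simp
  have h1 : E * E' = 1 := by rw [← Real.exp_add]; simp
  have hE' : 0 < E' := Real.exp_pos _
  have h3 : 1 + 2 * r ≤ E ^ 2 := by rw [← e1]; linarith [Real.add_one_le_exp (2 * r)]
  have h4 : E' * (1 + 2 * r) ≤ E := by
    calc E' * (1 + 2 * r) ≤ E' * E ^ 2 := by gcongr
      _ = E := by rw [sq, ← mul_assoc, mul_comm E', h1, one_mul]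
  have h5 : 0 ≤ E - E' := by
    have : E' ≤ E := Real.exp_le_exp.mpr (by linarith)
    linarith
  rw [e1, e2]
  have : ((E - E') / r) ^ 2 * (1 + r) / 2 - (E ^ 2 - E' ^ 2) / (2 * r) =
      (E - E') * (E - E' * (1 + 2 * r)) / (2 * r ^ 2) := by
    field_simp; ring
  have h6 : 0 ≤ (E - E') * (E - E' * (1 + 2 * r)) / (2 * r ^ 2) := by
    apply div_nonneg (mul_nonneg h5 (by linarith)) (by positivity)
  linarith

lemma norm_cexp (μ : ℂ) (t : ℝ) : ‖Complex.exp (μ * t)‖ = Real.exp (μ.re * t) := by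
  rw [Complex.norm_exp]; simp

lemma norm_int_le (F : ℝ[X]) (μ : ℂ) :
    ‖∫ t in (-1 : ℝ)..1, ((F.eval t : ℝ) : ℂ) * Complex.exp (μ * t)‖ ≤
      ∫ t in (-1 : ℝ)..1, |F.eval t| * Real.exp (μ.re * t) := by
  refine (intervalIntegral.norm_integral_le_integral_norm (by norm_num)).trans (le_of_eq ?_)
  congr 1; ext t
  rw [norm_mul, norm_cexp, Complex.norm_real, Real.norm_eq_abs]

lemma cs_bound (F : ℝ[X]) (μ : ℂ) :
    ‖∫ t in (-1 : ℝ)..1, ((F.eval t : ℝ) : ℂ) * Complex.exp (μ * t)‖ ^ 2 ≤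
      Ip (F * F) * Jint (2 * μ.re) := by
  have h1 := norm_int_le F μ
  set A := ∫ t in (-1 : ℝ)..1, |F.eval t| * Real.exp (μ.re * t) with hA
  have hq : ∀ s : ℝ, 0 ≤ Ip (F * F) * (s * s) + (-2 * A) * s + Jint (2 * μ.re) := by
    intro s
    have h0 : 0 ≤ ∫ t in (-1 : ℝ)..1, (|F.eval t| * s - Real.exp (μ.re * t)) ^ 2 :=
      intervalIntegral.integral_nonneg (by norm_num) (fun _ _ => sq_nonneg _)
    refine h0.trans (le_of_eq ?_)
    have hc := F.continuous
    unfold Ip Jint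
    rw [hA, ← intervalIntegral.integral_mul_const, ← intervalIntegral.integral_const_mul,
      ← intervalIntegral.integral_mul_const, ← intervalIntegral.integral_add,
      ← intervalIntegral.integral_add]
    · congr 1; ext t
      rw [eval_mul, ← abs_mul_abs_self (eval t F), show 2 * μ.re * t = μ.re * t + μ.re * t by ring, Real.exp_add]
      ring
    all_goals
      apply Continuous.intervalIntegrable
      fun_prop
  have h2 := discrim_le_zero hq
  unfold discrim at h2
  have h3 : A ^ 2 ≤ Ip (F * F) * Jint (2 * μ.re) := by nlinarith
  have h4 := norm_nonneg (∫ t in (-1 : ℝ)..1, ((F.eval t : ℝ) : ℂ) * Complex.exp (μ * t))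
  refine le_trans ?_ h3
  gcongr

lemma cs_bound' (F : ℝ[X]) (μ : ℂ) :
    ‖∫ t in (-1 : ℝ)..1, ((F.eval t : ℝ) : ℂ) * Complex.exp (μ * t)‖ ^ 2 ≤
      Ip (F * F) * (Jint μ.re ^ 2 * (1 + |μ.re|) / 2) :=
  (cs_bound F μ).trans (mul_le_mul_of_nonneg_left (Jint_two _) (Ip_sq_nonneg F))

lemma leg_int_bound (n : ℕ) (μ : ℂ) :
    ‖∫ t in (-1 : ℝ)..1, (((legendreP n).eval t : ℝ) : ℂ) * Complex.exp (μ * t)‖ ≤ Jint μ.re := by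
  refine (norm_int_le _ _).trans ?_
  have hc := (legendreP n).continuous
  apply intervalIntegral.integral_mono_on (by norm_num)
  · apply Continuous.intervalIntegrable; fun_prop
  · apply Continuous.intervalIntegrable; fun_prop
  · intro t ht
    have := legP_abs_le n t ht
    have h2 := Real.exp_pos (μ.re * t)
    nlinarith

lemma ibp_bound (H : ℝ[X]) (h1 : H.eval 1 = 0) (h2 : H.eval (-1) = 0) (μ : ℂ) :
    μ * ∫ t in (-1 : ℝ)..1, ((H.eval t : ℝ) : ℂ) * Complex.exp (μ * t) =
      - ∫ t in (-1 : ℝ)..1, (((derivative H).eval t : ℝ) : ℂ) * Complex.exp (μ * t) := by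
  have hd : ∀ t ∈ uIcc (-1 : ℝ) 1, HasDerivAt (fun t : ℝ => ((H.eval t : ℝ) : ℂ) * Complex.exp (μ * t))
      ((((derivative H).eval t : ℝ) : ℂ) * Complex.exp (μ * t) +
        μ * (((H.eval t : ℝ) : ℂ) * Complex.exp (μ * t))) t := by
    intro t _
    have a1 := (H.hasDerivAt t).ofReal_comp
    have a2 : HasDerivAt (fun t : ℝ => Complex.exp (μ * t)) (Complex.exp (μ * t) * μ) t := by
      have := (((hasDerivAt_id (t : ℂ)).const_mul μ).cexp).comp_ofReal
      simpa using this
    exact (a1.mul a2).congr_deriv (by ring)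
  have hc := H.continuous
  have hc' := (derivative H).continuous
  have i1 : IntervalIntegrable (fun t : ℝ => (((derivative H).eval t : ℝ) : ℂ) * Complex.exp (μ * t)) volume (-1) 1 := by
    apply Continuous.intervalIntegrable; fun_prop
  have i2 : IntervalIntegrable (fun t : ℝ => μ * (((H.eval t : ℝ) : ℂ) * Complex.exp (μ * t))) volume (-1) 1 := by
    apply Continuous.intervalIntegrable; fun_prop
  have h := intervalIntegral.integral_eq_sub_of_hasDerivAt hd (i1.add i2)
  rw [intervalIntegral.integral_add i1 i2, intervalIntegral.integral_const_mul, h1, h2] at h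
  simp at h
  linear_combination h

lemma poly_main (p N : ℕ) (hN : p + 1 < N) (F : ℝ[X]) (m : ℝ) (hm0 : 0 ≤ m)
    (hm : ∀ t ∈ Icc (-1 : ℝ) 1, |(derivative^[p + 1] F).eval t| ≤ m) (μ : ℂ) :
    ‖∫ t in (-1 : ℝ)..1, (((Tp N F).eval t : ℝ) : ℂ) * Complex.exp (μ * t)‖ ≤
      15 * (m * Jint μ.re * Real.sqrt N / ((N : ℝ) + 1 - p) ^ (p + 1)) := by
  have hNp : (p : ℝ) + 2 ≤ N := by exact_mod_cast hN
  have hp0 : (0 : ℝ) ≤ p := by positivity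
  obtain ⟨D, hDdef⟩ : ∃ D : ℝ, D = (N : ℝ) + 1 - p := ⟨_, rfl⟩
  rw [← hDdef]
  have hD1 : 1 ≤ D := by linarith
  have hk : D + (p + 1 : ℕ) ≤ (N : ℝ) + 2 := by push_cast; linarith
  have hJ := Jint_nonneg μ.re
  have hsN : Real.sqrt N ^ 2 = N := Real.sq_sqrt (by positivity)
  have hDk : 0 < D ^ (p + 1) := by positivity
  set Y := m * Jint μ.re * Real.sqrt N / D ^ (p + 1) with hY
  have hY0 : 0 ≤ Y := by positivity
  have hY2 : Y ^ 2 * (D ^ (p + 1)) ^ 2 = m ^ 2 * Jint μ.re ^ 2 * N := by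
    rw [hY, div_pow, div_mul_cancel₀ _ (by positivity), mul_pow, mul_pow, hsN]
  have fin : ∀ (z c : ℝ), 0 ≤ c → z ^ 2 * (D ^ (p + 1)) ^ 2 ≤ c ^ 2 * (m ^ 2 * Jint μ.re ^ 2 * N) →
      z ≤ c * Y := by
    intro z c hc h
    rw [← hY2, ← mul_assoc] at h
    have h' := le_of_mul_le_mul_right h (by positivity)
    rw [← mul_pow] at h'
    exact le_of_sq_le_sq h' (by positivity) 
  rcases le_or_gt |μ.re| N with hr | hr
  · have h1 := cs_bound' (Tp N F) μ
    have h2 := (Tp_iter (p + 1) N D F (by linarith) hk hD1).trans (Ip_sq_le_of_abs _ _ hm)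
    have h3 : ‖∫ t in (-1 : ℝ)..1, (((Tp N F).eval t : ℝ) : ℂ) * Complex.exp (μ * t)‖ ≤ 2 * Y := by
      apply fin _ _ (by norm_num)
      calc _ ≤ Ip (Tp N F * Tp N F) * (Jint μ.re ^ 2 * (1 + |μ.re|) / 2) * (D ^ (p + 1)) ^ 2 := by
            exact mul_le_mul_of_nonneg_right h1 (by positivity)
        _ = Ip (Tp N F * Tp N F) * (D ^ (p + 1)) ^ 2 * (Jint μ.re ^ 2 * (1 + |μ.re|) / 2) := by ring
        _ ≤ 2 * m ^ 2 * (Jint μ.re ^ 2 * (1 + |μ.re|) / 2) :=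
            mul_le_mul_of_nonneg_right h2 (by positivity)
        _ = m ^ 2 * Jint μ.re ^ 2 * (1 + |μ.re|) := by ring
        _ ≤ m ^ 2 * Jint μ.re ^ 2 * (4 * N) := by
            apply mul_le_mul_of_nonneg_left _ (by positivity)
            linarith
        _ = _ := by ring
    linarith
  · obtain ⟨H, α, β, hT, hH1, hH2, hdH, hα, hβ⟩ := Tp_decomp p N D hD1 hk F m hm
    have hc := H.continuous
    have hcl := fun n => (legendreP n).continuous
    have split : ∫ t in (-1 : ℝ)..1, (((Tp N F).eval t : ℝ) : ℂ) * Complex.exp (μ * t) =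
        (∫ t in (-1 : ℝ)..1, ((H.eval t : ℝ) : ℂ) * Complex.exp (μ * t))
        + α * (∫ t in (-1 : ℝ)..1, (((legendreP (N + 1)).eval t : ℝ) : ℂ) * Complex.exp (μ * t))
        + β * (∫ t in (-1 : ℝ)..1, (((legendreP (N + 2)).eval t : ℝ) : ℂ) * Complex.exp (μ * t)) := by
      rw [← intervalIntegral.integral_const_mul, ← intervalIntegral.integral_const_mul,
        ← intervalIntegral.integral_add, ← intervalIntegral.integral_add]
      · congr 1; ext t
        rw [hT]; simp; ring
      all_goals
        have := hcl (N + 1)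
        have := hcl (N + 2)
        apply Continuous.intervalIntegrable
        fun_prop
    have hN0 : (0 : ℝ) < N := by linarith
    have hH : ‖∫ t in (-1 : ℝ)..1, ((H.eval t : ℝ) : ℂ) * Complex.exp (μ * t)‖ ≤ 3 * Y := by
      apply fin _ _ (by norm_num)
      have e := congrArg norm (ibp_bound H hH1 hH2 μ)
      rw [norm_mul, norm_neg] at e
      have h1 := cs_bound' (derivative H) μ
      rw [← e, mul_pow] at h1
      set z := ‖∫ t in (-1 : ℝ)..1, ((H.eval t : ℝ) : ℂ) * Complex.exp (μ * t)‖
      have hμ : |μ.re| ≤ ‖μ‖ := Complex.abs_re_le_norm μ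
      have hr0 : 0 < |μ.re| := by linarith
      have h2 : |μ.re| ^ 2 * z ^ 2 ≤ Ip (derivative H * derivative H) * (Jint μ.re ^ 2 * |μ.re|) := by
        calc |μ.re| ^ 2 * z ^ 2 ≤ ‖μ‖ ^ 2 * z ^ 2 := by gcongr
          _ ≤ _ := h1
          _ ≤ _ := by
            apply mul_le_mul_of_nonneg_left _ (Ip_sq_nonneg _)
            rw [mul_div_assoc]
            apply mul_le_mul_of_nonneg_left _ (by positivity)
            linarith
      have h3 : |μ.re| * z ^ 2 ≤ Ip (derivative H * derivative H) * Jint μ.re ^ 2 := by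
        apply le_of_mul_le_mul_left _ hr0
        linarith
      have h4 : N * z ^ 2 ≤ Ip (derivative H * derivative H) * Jint μ.re ^ 2 :=
        le_trans (by gcongr) h3
      have h5 : N * z ^ 2 * (D ^ p) ^ 2 ≤ 2 * m ^ 2 * Jint μ.re ^ 2 := by
        calc N * z ^ 2 * (D ^ p) ^ 2
            ≤ Ip (derivative H * derivative H) * Jint μ.re ^ 2 * (D ^ p) ^ 2 :=
              mul_le_mul_of_nonneg_right h4 (by positivity)
          _ = Ip (derivative H * derivative H) * (D ^ p) ^ 2 * Jint μ.re ^ 2 := by ring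
          _ ≤ _ := mul_le_mul_of_nonneg_right hdH (by positivity)
      have hD2 : D ≤ 2 * N := by linarith
      have h6 : D ^ 2 ≤ (2 * N : ℝ) ^ 2 := by gcongr
      calc z ^ 2 * (D ^ (p + 1)) ^ 2 = z ^ 2 * (D ^ p) ^ 2 * D ^ 2 := by ring
        _ ≤ z ^ 2 * (D ^ p) ^ 2 * (2 * N) ^ 2 := mul_le_mul_of_nonneg_left h6 (by positivity)
        _ = 4 * N * (N * z ^ 2 * (D ^ p) ^ 2) := by ring
        _ ≤ 4 * N * (2 * m ^ 2 * Jint μ.re ^ 2) := mul_le_mul_of_nonneg_left h5 (by positivity)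
        _ ≤ 3 ^ 2 * (m ^ 2 * Jint μ.re ^ 2 * N) := by
          have : 0 ≤ m ^ 2 * Jint μ.re ^ 2 * N := by positivity
          linarith
    have hab : ∀ (c : ℝ) (n : ℕ), c ^ 2 * (D ^ (p + 1)) ^ 2 ≤ 8 * (N + 3) * m ^ 2 →
        ‖(c : ℂ) * (∫ t in (-1 : ℝ)..1, (((legendreP n).eval t : ℝ) : ℂ) * Complex.exp (μ * t))‖ ≤ 6 * Y := by
      intro c n h
      rw [norm_mul, Complex.norm_real, Real.norm_eq_abs]
      refine (mul_le_mul_of_nonneg_left (leg_int_bound n μ) (abs_nonneg c)).trans ?_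
      apply fin _ _ (by norm_num)
      rw [mul_pow, sq_abs]
      calc c ^ 2 * Jint μ.re ^ 2 * (D ^ (p + 1)) ^ 2
          = c ^ 2 * (D ^ (p + 1)) ^ 2 * Jint μ.re ^ 2 := by ring
        _ ≤ 8 * (N + 3) * m ^ 2 * Jint μ.re ^ 2 := mul_le_mul_of_nonneg_right h (by positivity)
        _ = (m ^ 2 * Jint μ.re ^ 2) * (8 * (N + 3)) := by ring
        _ ≤ (m ^ 2 * Jint μ.re ^ 2) * (36 * N) := by
          apply mul_le_mul_of_nonneg_left _ (by positivity)
          linarith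
        _ = _ := by ring
    rw [split]
    refine (norm_add₃_le).trans ?_
    have := hab α (N + 1) hα
    have := hab β (N + 2) hβ
    linarith

/-- constant -/
lemma const_bound (p N : ℕ) (hN : p + 1 < N) :
    Real.sqrt N / ((N : ℝ) + 1 - p) ^ (p + 1) ≤
      ((p : ℝ) + 2) ^ (p + 1) / (N : ℝ) ^ ((p : ℝ) + 1 / 2) := by
  have hNp : (p : ℝ) + 2 ≤ N := by exact_mod_cast hN
  have hp0 : (0 : ℝ) ≤ p := by positivity
  have hN0 : (0 : ℝ) < N := by linarith
  have hD : 0 < (N : ℝ) + 1 - p := by linarith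
  rw [div_le_div_iff₀ (by positivity) (by positivity), ← mul_pow]
  have e : Real.sqrt N * (N : ℝ) ^ ((p : ℝ) + 1 / 2) = (N : ℝ) ^ (p + 1) := by
    rw [Real.sqrt_eq_rpow, ← Real.rpow_add hN0, ← Real.rpow_natCast]
    congr 1; push_cast; ring
  rw [e]
  gcongr
  nlinarith

lemma poly_main' (p N : ℕ) (hN : p + 1 < N) (F : ℝ[X]) (m : ℝ) (hm0 : 0 ≤ m)
    (hm : ∀ t ∈ Icc (-1 : ℝ) 1, |(derivative^[p + 1] F).eval t| ≤ m) (μ : ℂ) :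
    ‖∫ t in (-1 : ℝ)..1, (((Tp N F).eval t : ℝ) : ℂ) * Complex.exp (μ * t)‖ ≤
      15 * ((p : ℝ) + 2) ^ (p + 1) / (N : ℝ) ^ ((p : ℝ) + 1 / 2) * Jint μ.re * m := by
  refine (poly_main p N hN F m hm0 hm μ).trans ?_
  have h1 := const_bound p N hN
  have h2 := mul_le_mul_of_nonneg_left h1 (mul_nonneg hm0 (Jint_nonneg μ.re))
  calc _ = 15 * (m * Jint μ.re * (√↑N / (↑N + 1 - ↑p) ^ (p + 1))) := by ring
    _ ≤ _ := mul_le_mul_of_nonneg_left h2 (by norm_num)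
    _ = _ := by ring

lemma approx_lemma {E : Type*} [NormedAddCommGroup E] [NormedSpace ℝ E] (L : E →L[ℝ] ℝ)
    (x : ℝ) (hx : 0 < x) (m : ℝ) (k : ℕ) : ∀ (f : ℝ → E) (_ : ContDiffOn ℝ k f (Icc (-x) x))
    (_ : ∀ t ∈ Icc (-x) x, |L (iteratedDerivWithin k f (Icc (-x) x) t)| ≤ m) (ε : ℝ) (_ : 0 < ε),
    ∃ F : ℝ[X], (∀ t ∈ Icc (-x) x, |L (f t) - F.eval t| ≤ ε) ∧
      ∀ t ∈ Icc (-x) x, |(derivative^[k] F).eval t| ≤ m + ε := by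
  have hu : UniqueDiffOn ℝ (Icc (-x) x) := uniqueDiffOn_Icc (by linarith)
  induction k with
  | zero =>
    intro f hf hm ε hε
    have hc : ContinuousOn (fun t => L (f t)) (Icc (-x) x) :=
      L.continuous.comp_continuousOn hf.continuousOn
    obtain ⟨F, hF⟩ := exists_polynomial_near_of_continuousOn (-x) x _ hc ε hε
    refine ⟨F, fun t ht => ?_, fun t ht => ?_⟩
    · rw [abs_sub_comm]; exact (hF t ht).le
    · have h1 := hm t ht
      have h2 := hF t ht
      simp at h1 ⊢
      have h3 := abs_add_le (F.eval t - L (f t)) (L (f t))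
      rw [sub_add_cancel] at h3
      linarith
  | succ k ih =>
    intro f hf hm ε hε
    have hf' : ContDiffOn ℝ k (derivWithin f (Icc (-x) x)) (Icc (-x) x) :=
      hf.derivWithin hu (by norm_cast)
    have hd : DifferentiableOn ℝ f (Icc (-x) x) := hf.differentiableOn (by norm_cast)
    set δ := ε / (2 * x + 1) with hδ
    have hδ0 : 0 < δ := by positivity
    have hδε : δ ≤ ε := by
      rw [hδ, div_le_iff₀ (by positivity)]; nlinarith
    obtain ⟨F1, h1, h2⟩ := ih _ hf' (by
      intro t ht
      have := hm t ht
      rwa [iteratedDerivWithin_succ'] at this) δ hδ0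
    obtain ⟨G0, hG0, -, -⟩ := exists_anti F1 0
    set G := G0 + C (L (f (-x)) - G0.eval (-x)) with hG
    have hGd : derivative G = F1 := by rw [hG, derivative_add, hG0, derivative_C, add_zero]
    have hGx : G.eval (-x) = L (f (-x)) := by simp [hG]
    refine ⟨G, fun t ht => ?_, fun t ht => ?_⟩
    · have hder : ∀ s ∈ Icc (-x) x, HasDerivWithinAt (fun s => L (f s) - G.eval s)
          (L (derivWithin f (Icc (-x) x) s) - F1.eval s) (Icc (-x) x) s := by
        intro s hs
        have a1 := L.hasFDerivAt.comp_hasDerivWithinAt s (hd s hs).hasDerivWithinAt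
        have a2 := (G.hasDerivAt s).hasDerivWithinAt (s := Icc (-x) x)
        rw [hGd] at a2
        exact a1.sub a2
      have := (convex_Icc (-x) x).norm_image_sub_le_of_norm_hasDerivWithin_le (C := δ) hder
        (fun s hs => h1 s hs) (left_mem_Icc.mpr (by linarith)) ht
      simp only [hGx, sub_self, sub_zero, Real.norm_eq_abs] at this
      refine this.trans ?_
      rw [sub_neg_eq_add]
      have h3 : |t + x| ≤ 2 * x := by rw [abs_le]; constructor <;> linarith [ht.1, ht.2]
      calc δ * |t + x| ≤ δ * (2 * x + 1) := by gcongr; linarith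
        _ = ε := by rw [hδ]; field_simp
    · rw [Function.iterate_succ_apply, hGd]
      exact (h2 t ht).trans (by linarith)

/-- The pairing of the Legendre remainder with the exponential. -/
def Lam (N : ℕ) (μ : ℂ) (f : ℝ → ℂ) : ℂ :=
  (∫ t in (-1 : ℝ)..1, f t * Complex.exp (μ * t)) -
    ∑ n ∈ Finset.range (N + 1), ((2 * (n : ℂ) + 1) / 2) *
      (∫ t in (-1 : ℝ)..1, ((((legendreP n).eval t : ℝ) : ℂ)) * f t) *
      (∫ t in (-1 : ℝ)..1, ((((legendreP n).eval t : ℝ) : ℂ)) * Complex.exp (μ * t))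

lemma legc_cont (n : ℕ) : Continuous fun t : ℝ => (((legendreP n).eval t : ℝ) : ℂ) :=
  Complex.continuous_ofReal.comp (legendreP n).continuous

lemma ii_of_contOn {f g : ℝ → ℂ} (hf : ContinuousOn f (Icc (-1) 1)) (hg : Continuous g) :
    IntervalIntegrable (fun t => f t * g t) volume (-1) 1 := by
  apply ContinuousOn.intervalIntegrable
  rw [uIcc_of_le (by norm_num)]
  exact hf.mul hg.continuousOn

lemma Lam_add_smul (N : ℕ) (μ : ℂ) (f g : ℝ → ℂ) (c : ℂ) (hf : ContinuousOn f (Icc (-1) 1))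
    (hg : ContinuousOn g (Icc (-1) 1)) :
    Lam N μ (fun t => f t + c * g t) = Lam N μ f + c * Lam N μ g := by
  have he : Continuous fun t : ℝ => Complex.exp (μ * t) := by fun_prop
  have h : ∀ φ : ℝ → ℂ, Continuous φ → ∫ t in (-1 : ℝ)..1, (f t + c * g t) * φ t =
      (∫ t in (-1 : ℝ)..1, f t * φ t) + c * ∫ t in (-1 : ℝ)..1, g t * φ t := by
    intro φ hφ
    rw [← intervalIntegral.integral_const_mul, ← intervalIntegral.integral_add]
    · congr 1; ext t; ring
    · exact ii_of_contOn hf hφ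
    · exact (ii_of_contOn hg hφ).const_mul c
  unfold Lam
  rw [h _ he, mul_sub, Finset.mul_sum]
  have : ∀ n ∈ Finset.range (N + 1), ((2 * (n : ℂ) + 1) / 2) *
      (∫ t in (-1 : ℝ)..1, ((((legendreP n).eval t : ℝ) : ℂ)) * (f t + c * g t)) *
      (∫ t in (-1 : ℝ)..1, ((((legendreP n).eval t : ℝ) : ℂ)) * Complex.exp (μ * t)) =
      ((2 * (n : ℂ) + 1) / 2) *
      (∫ t in (-1 : ℝ)..1, ((((legendreP n).eval t : ℝ) : ℂ)) * f t) *
      (∫ t in (-1 : ℝ)..1, ((((legendreP n).eval t : ℝ) : ℂ)) * Complex.exp (μ * t)) +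
      c * (((2 * (n : ℂ) + 1) / 2) *
      (∫ t in (-1 : ℝ)..1, ((((legendreP n).eval t : ℝ) : ℂ)) * g t) *
      (∫ t in (-1 : ℝ)..1, ((((legendreP n).eval t : ℝ) : ℂ)) * Complex.exp (μ * t))) := by
    intro n _
    have := h _ (legc_cont n)
    simp only [mul_comm _ (((legendreP n).eval _ : ℝ) : ℂ)] at this
    rw [this]; ring
  rw [Finset.sum_congr rfl this, Finset.sum_add_distrib]
  ring

lemma Lam_small (N : ℕ) (μ : ℂ) : ∃ B : ℝ, 0 ≤ B ∧ ∀ (f : ℝ → ℂ) (ε : ℝ),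
    (∀ t ∈ Icc (-1 : ℝ) 1, ‖f t‖ ≤ ε) → ‖Lam N μ f‖ ≤ ε * B := by
  have he : Continuous fun t : ℝ => Complex.exp (μ * t) := by fun_prop
  have h : ∀ φ : ℝ → ℂ, Continuous φ → ∀ (f : ℝ → ℂ) (ε : ℝ),
      (∀ t ∈ Icc (-1 : ℝ) 1, ‖f t‖ ≤ ε) →
      ‖∫ t in (-1 : ℝ)..1, f t * φ t‖ ≤ ε * ∫ t in (-1 : ℝ)..1, ‖φ t‖ := by
    intro φ hφ f ε hf
    rw [← intervalIntegral.integral_const_mul]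
    apply intervalIntegral.norm_integral_le_of_norm_le (by norm_num)
    · refine Filter.Eventually.of_forall fun t ht => ?_
      rw [norm_mul]
      exact mul_le_mul_of_nonneg_right (hf t ⟨ht.1.le, ht.2⟩) (norm_nonneg _)
    · apply Continuous.intervalIntegrable; fun_prop
  have hn : ∀ φ : ℝ → ℂ, 0 ≤ ∫ t in (-1 : ℝ)..1, ‖φ t‖ := fun φ =>
    intervalIntegral.integral_nonneg (by norm_num) fun _ _ => norm_nonneg _
  refine ⟨(∫ t in (-1 : ℝ)..1, ‖Complex.exp (μ * t)‖) + ∑ n ∈ Finset.range (N + 1),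
    ‖((2 * (n : ℂ) + 1) / 2)‖ * (∫ t in (-1 : ℝ)..1, ‖((((legendreP n).eval t : ℝ) : ℂ))‖) *
    ‖(∫ t in (-1 : ℝ)..1, ((((legendreP n).eval t : ℝ) : ℂ)) * Complex.exp (μ * t))‖, ?_, ?_⟩
  · refine add_nonneg (hn _) (Finset.sum_nonneg fun n _ => ?_)
    have := hn fun t : ℝ => ((((legendreP n).eval t : ℝ) : ℂ))
    positivity
  · intro f ε hf
    unfold Lam
    refine (norm_sub_le _ _).trans ?_
    rw [mul_add]
    refine add_le_add (h _ he f ε hf) ?_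
    refine (norm_sum_le _ _).trans ?_
    rw [Finset.mul_sum]
    apply Finset.sum_le_sum
    intro n _
    rw [norm_mul, norm_mul]
    have := h _ (legc_cont n) f ε hf
    simp only [mul_comm _ (((legendreP n).eval _ : ℝ) : ℂ)] at this
    calc _ ≤ ‖((2 * (n : ℂ) + 1) / 2)‖ * (ε * ∫ t in (-1 : ℝ)..1, ‖((((legendreP n).eval t : ℝ) : ℂ))‖) *
      ‖(∫ t in (-1 : ℝ)..1, ((((legendreP n).eval t : ℝ) : ℂ)) * Complex.exp (μ * t))‖ := by gcongr
      _ = _ := by ring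

lemma Lam_poly (N : ℕ) (μ : ℂ) (F : ℝ[X]) : Lam N μ (fun t => ((F.eval t : ℝ) : ℂ)) =
    ∫ t in (-1 : ℝ)..1, (((Tp N F).eval t : ℝ) : ℂ) * Complex.exp (μ * t) := by
  have he : Continuous fun t : ℝ => Complex.exp (μ * t) := by fun_prop
  have hF : Continuous fun t : ℝ => ((F.eval t : ℝ) : ℂ) :=
    Complex.continuous_ofReal.comp F.continuous
  have e : ∀ t : ℝ, (((Tp N F).eval t : ℝ) : ℂ) * Complex.exp (μ * t) =
      ((F.eval t : ℝ) : ℂ) * Complex.exp (μ * t) - ∑ n ∈ Finset.range (N + 1),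
        ((lc n F : ℝ) : ℂ) * ((((legendreP n).eval t : ℝ) : ℂ) * Complex.exp (μ * t)) := by
    intro t
    unfold Tp Sp
    rw [eval_sub, eval_finsetSum]
    push_cast
    rw [sub_mul, Finset.sum_mul]
    congr 1
    apply Finset.sum_congr rfl
    intro n _
    simp; ring
  simp only [e]
  rw [intervalIntegral.integral_sub, intervalIntegral.integral_finsetSum]
  · unfold Lam
    congr 1
    apply Finset.sum_congr rfl
    intro n _
    rw [intervalIntegral.integral_const_mul]
    congr 1
    unfold lc Ip
    push_cast
    congr 1
    rw [← intervalIntegral.integral_ofReal]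
    congr 1; ext t
    simp
  · intro n _
    apply Continuous.intervalIntegrable
    exact continuous_const.mul ((legc_cont n).mul he)
  · exact (hF.mul he).intervalIntegrable _ _
  · apply Continuous.intervalIntegrable
    exact continuous_finsetSum _ fun n _ => continuous_const.mul ((legc_cont n).mul he)

/-- The constant. -/
def Cst (p N : ℕ) : ℝ := 15 * ((p : ℝ) + 2) ^ (p + 1) / (N : ℝ) ^ ((p : ℝ) + 1 / 2)

lemma Lam_real {E : Type*} [NormedAddCommGroup E] [NormedSpace ℝ E] (L : E →L[ℝ] ℝ)
    (x : ℝ) (hx : 0 < x) (m : ℝ) (hm0 : 0 ≤ m) (p : ℕ) (f : ℝ → E)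
    (hf : ContDiffOn ℝ (p + 1 : ℕ) f (Icc (-x) x))
    (hm : ∀ t ∈ Icc (-x) x, |L (iteratedDerivWithin (p + 1) f (Icc (-x) x) t)| ≤ m)
    (N : ℕ) (hN : p + 1 < N) (μ : ℂ) :
    ‖Lam N μ (fun t => ((L (f (x * t)) : ℝ) : ℂ))‖ ≤ Cst p N * Jint μ.re * (x ^ (p + 1) * m) := by
  obtain ⟨B, hB0, hB⟩ := Lam_small N μ
  have hC0 : 0 ≤ Cst p N * Jint μ.re := by
    have := Jint_nonneg μ.re
    unfold Cst; positivity
  apply le_of_forall_pos_le_add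
  intro δ hδ
  set K := Cst p N * Jint μ.re * x ^ (p + 1) + B + 1 with hK
  have hK0 : 0 < K := by positivity
  set ε := δ / K with hε
  have hε0 : 0 < ε := by positivity
  obtain ⟨F, h1, h2⟩ := approx_lemma L x hx m (p + 1) f hf hm ε hε0
  have hmem : ∀ t ∈ Icc (-1 : ℝ) 1, x * t ∈ Icc (-x) x := by
    intro t ht
    constructor <;> nlinarith [ht.1, ht.2]
  set G : ℝ[X] := F.comp (C x * X) with hG
  have hGe : ∀ t, G.eval t = F.eval (x * t) := by intro t; simp [hG]
  have hGd : ∀ k t, (derivative^[k] G).eval t = x ^ k * (derivative^[k] F).eval (x * t) := by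
    have : ∀ k, derivative^[k] G = C (x ^ k) * (derivative^[k] F).comp (C x * X) := by
      intro k
      induction k with
      | zero => simp [hG]
      | succ k ih =>
        rw [Function.iterate_succ_apply', ih, derivative_C_mul, derivative_comp,
          Function.iterate_succ_apply']
        simp [pow_succ]
        ring
    intro k t
    rw [this]; simp
  have hmain := poly_main' p N hN G (x ^ (p + 1) * (m + ε)) (by positivity) (by
    intro t ht
    rw [hGd, abs_mul, abs_of_pos (by positivity : 0 < x ^ (p + 1))]
    exact mul_le_mul_of_nonneg_left (h2 _ (hmem t ht)) (by positivity)) μ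
  rw [← Lam_poly] at hmain
  have hcL : ContinuousOn (fun t => ((L (f (x * t)) : ℝ) : ℂ)) (Icc (-1) 1) := by
    apply Complex.continuous_ofReal.comp_continuousOn
    apply L.continuous.comp_continuousOn
    exact hf.continuousOn.comp (by fun_prop) hmem
  have hcG : ContinuousOn (fun t => ((G.eval t : ℝ) : ℂ)) (Icc (-1) 1) :=
    (Complex.continuous_ofReal.comp G.continuous).continuousOn
  have hs := hB (fun t => ((L (f (x * t)) : ℝ) : ℂ) + (-1) * ((G.eval t : ℝ) : ℂ)) ε (by
    intro t ht
    have := h1 _ (hmem t ht)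
    rw [hGe]
    rw [neg_one_mul, ← sub_eq_add_neg, ← Complex.ofReal_sub, Complex.norm_real, Real.norm_eq_abs]
    exact this)
  rw [Lam_add_smul N μ _ _ _ hcL hcG] at hs
  have ht := norm_add_le (Lam N μ (fun t => ((L (f (x * t)) : ℝ) : ℂ)) + (-1) * Lam N μ (fun t => ((G.eval t : ℝ) : ℂ)))
    (Lam N μ (fun t => ((G.eval t : ℝ) : ℂ)))
  rw [neg_one_mul, neg_add_cancel_right] at ht
  rw [neg_one_mul] at hs
  have hfin : Cst p N * Jint μ.re * x ^ (p + 1) * ε + ε * B ≤ δ := by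
    have : ε * K = δ := by rw [hε]; field_simp
    rw [← this, hK]
    nlinarith
  have e : Cst p N * Jint μ.re * (x ^ (p + 1) * (m + ε)) = Cst p N * Jint μ.re * (x ^ (p + 1) * m)
    + Cst p N * Jint μ.re * x ^ (p + 1) * ε := by ring
  change _ ≤ Cst p N * Jint μ.re * (x ^ (p + 1) * (m + ε)) at hmain
  rw [e] at hmain
  linarith

lemma entry_le_opNorm (A : M2) (i l : Fin 2) : ‖A i l‖ ≤ opNorm A := by
  unfold opNorm
  have h1 := (Matrix.toEuclideanCLM (𝕜 := ℂ) A).le_opNorm (EuclideanSpace.single l 1)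
  have h2 := PiLp.norm_apply_le (Matrix.toEuclideanCLM (𝕜 := ℂ) A (EuclideanSpace.single l 1)) i
  have h3 : (Matrix.toEuclideanCLM (𝕜 := ℂ) A (EuclideanSpace.single l 1)) i = A i l := by
    simp
  rw [h3] at h2
  simp at h1
  exact h2.trans h1

lemma opNorm_le_entries (A : M2) (c : ℝ) (h : ∀ i j, ‖A i j‖ ≤ c) : opNorm A ≤ 4 * c := by
  have hc : 0 ≤ c := (norm_nonneg _).trans (h 0 0)
  unfold opNorm
  apply ContinuousLinearMap.opNorm_le_bound _ (by positivity)
  intro v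
  have hv : ∀ i, ‖(Matrix.toEuclideanCLM (𝕜 := ℂ) A v) i‖ ≤ 2 * c * ‖v‖ := by
    intro i
    have e : (Matrix.toEuclideanCLM (𝕜 := ℂ) A v) i = A i 0 * v 0 + A i 1 * v 1 := by
      rw [Matrix.ofLp_toEuclideanCLM]
      simp [Matrix.mulVec, dotProduct, Fin.sum_univ_two]
    rw [e]
    refine (norm_add_le _ _).trans ?_
    rw [norm_mul, norm_mul]
    have h0 := mul_le_mul (h i 0) (PiLp.norm_apply_le v 0) (norm_nonneg _) hc
    have h1 := mul_le_mul (h i 1) (PiLp.norm_apply_le v 1) (norm_nonneg _) hc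
    linarith
  rw [EuclideanSpace.norm_eq, Fin.sum_univ_two]
  apply Real.sqrt_le_iff.mpr
  refine ⟨by positivity, ?_⟩
  have h0 := pow_le_pow_left₀ (norm_nonneg _) (hv 0) 2
  have h1 := pow_le_pow_left₀ (norm_nonneg _) (hv 1) 2
  nlinarith [sq_nonneg (c * ‖v‖)]

/-- entry of a matrix as a real-continuous-linear map -/
def entryL (i j : Fin 2) : M2 →L[ℝ] ℂ :=
  LinearMap.toContinuousLinearMap
    { toFun := fun A => A i j, map_add' := fun _ _ => rfl, map_smul' := fun _ _ => rfl }

lemma entryL_apply (i j : Fin 2) (A : M2) : entryL i j A = A i j := rfl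

lemma integral_clm {E : Type} [NormedAddCommGroup E] [NormedSpace ℝ E] [CompleteSpace E]
    (L : E →L[ℝ] ℂ) (f : ℝ → E) (a b : ℝ) (hab : a ≤ b) (hf : ContinuousOn f (Icc a b)) :
    L (∫ t in a..b, f t) = ∫ t in a..b, L (f t) := by
  rw [← ContinuousLinearMap.intervalIntegral_comp_comm]
  apply ContinuousOn.intervalIntegrable
  rwa [uIcc_of_le hab]

/-- entry projection on the underlying function space -/
def entryP (i j : Fin 2) : (Fin 2 → Fin 2 → ℂ) →L[ℝ] ℂ :=
  (ContinuousLinearMap.proj (R := ℝ) (φ := fun _ : Fin 2 => ℂ) j).comp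
    (ContinuousLinearMap.proj (R := ℝ) (φ := fun _ : Fin 2 => Fin 2 → ℂ) i)

lemma integral_entry (i j : Fin 2) (f : ℝ → M2) (a b : ℝ) (hab : a ≤ b)
    (hf : ContinuousOn f (Icc a b)) :
    (∫ t in a..b, f t) i j = ∫ t in a..b, f t i j :=
  integral_clm (entryP i j) f a b hab hf

lemma entry_contOn (i j : Fin 2) (f : ℝ → M2) (s : Set ℝ) (hf : ContinuousOn f s) :
    ContinuousOn (fun t => f t i j) s := (entryL i j).continuous.comp_continuousOn hf

lemma contOn_of_entry (f : ℝ → M2) (s : Set ℝ) (hf : ∀ i j, ContinuousOn (fun t => f t i j) s) :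
    ContinuousOn f s := by
  have h : ContinuousOn (fun t => (f t : Fin 2 → Fin 2 → ℂ)) s :=
    continuousOn_pi.mpr fun i => continuousOn_pi.mpr fun j => hf i j
  exact h

lemma Lam_entry (x : ℝ) (hx : 0 < x) (M : ℝ) (p : ℕ) (f : ℝ → M2)
    (hf : ContDiffOn ℝ (p + 1 : ℕ) f (Icc (-x) x))
    (hm : ∀ t ∈ Icc (-x) x, opNorm (iteratedDerivWithin (p + 1) f (Icc (-x) x) t) ≤ M)
    (N : ℕ) (hN : p + 1 < N) (μ : ℂ) (i l : Fin 2) :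
    ‖Lam N μ (fun t => f (x * t) i l)‖ ≤ 2 * (Cst p N * Jint μ.re * (x ^ (p + 1) * M)) := by
  have hM0 : 0 ≤ M := (norm_nonneg _).trans (hm 0 ⟨by linarith, hx.le⟩)
  have h1 := Lam_real (Complex.reCLM.comp (entryL i l)) x hx M hM0 p f hf (fun t ht =>
    (Complex.abs_re_le_norm _).trans ((entry_le_opNorm _ i l).trans (hm t ht))) N hN μ
  have h2 := Lam_real (Complex.imCLM.comp (entryL i l)) x hx M hM0 p f hf (fun t ht =>
    (Complex.abs_im_le_norm _).trans ((entry_le_opNorm _ i l).trans (hm t ht))) N hN μ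
  have hmem : ∀ t ∈ Icc (-1 : ℝ) 1, x * t ∈ Icc (-x) x := by
    intro t ht
    constructor <;> nlinarith [ht.1, ht.2]
  have hcL : ∀ L : M2 →L[ℝ] ℝ, ContinuousOn (fun t => ((L (f (x * t)) : ℝ) : ℂ)) (Icc (-1) 1) := by
    intro L
    apply Complex.continuous_ofReal.comp_continuousOn
    apply L.continuous.comp_continuousOn
    exact hf.continuousOn.comp (by fun_prop) hmem
  have h3 := Lam_add_smul N μ _ _ Complex.I (hcL (Complex.reCLM.comp (entryL i l)))
    (hcL (Complex.imCLM.comp (entryL i l)))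
  have e : (fun t => f (x * t) i l) = fun t : ℝ =>
      (((Complex.reCLM.comp (entryL i l)) (f (x * t)) : ℝ) : ℂ) +
      Complex.I * (((Complex.imCLM.comp (entryL i l)) (f (x * t)) : ℝ) : ℂ) := by
    ext t
    rw [mul_comm Complex.I]
    exact (Complex.re_add_im (f (x * t) i l)).symm
  rw [e, h3]
  refine (norm_add_le _ _).trans ?_
  rw [norm_mul, Complex.norm_I, one_mul]
  exact (add_le_add h1 h2).trans (le_of_eq (by ring))

lemma scale_int (x : ℝ) (g : ℝ → ℂ) :
    ∫ t in (-x)..x, g t = x * ∫ s in (-1 : ℝ)..1, g (x * s) := by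
  have := intervalIntegral.smul_integral_comp_mul_left (a := -1) (b := 1) g x
  simp only [mul_neg, mul_one] at this
  rw [← this, Complex.real_smul]

lemma Kcoef_entry (K : ℝ → ℝ → M2) (n : ℕ) (x : ℝ) (hx : 0 < x)
    (hK : ContinuousOn (K x) (Icc (-x) x)) (i l : Fin 2) :
    Kcoef K n x i l = ((2 * (n : ℂ) + 1) / 2) * (x *
      ∫ t in (-1 : ℝ)..1, ((((legendreP n).eval t : ℝ) : ℂ)) * K x (x * t) i l) := by
  unfold Kcoef
  have hii : ContinuousOn (fun t => ((legendreP n).eval (t / x)) • K x t) (Icc (-x) x) := by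
    have h : Continuous fun t : ℝ => (legendreP n).eval (t / x) :=
      (legendreP n).continuous.comp (continuous_id.div_const x)
    exact h.continuousOn.smul hK
  rw [Matrix.smul_apply, integral_entry i l _ _ _ (by linarith) hii, scale_int, Complex.real_smul]
  push_cast
  congr 2
  congr 1; ext t
  rw [Matrix.smul_apply, Complex.real_smul, mul_div_cancel_left₀ _ hx.ne']

lemma KN_entry (K : ℝ → ℝ → M2) (N : ℕ) (x s : ℝ) (hx : 0 < x)
    (hK : ContinuousOn (K x) (Icc (-x) x)) (i l : Fin 2) :
    KN K N x (x * s) i l = ∑ n ∈ Finset.range (N + 1), ((2 * (n : ℂ) + 1) / 2) *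
      (∫ t in (-1 : ℝ)..1, ((((legendreP n).eval t : ℝ) : ℂ)) * K x (x * t) i l) *
      (((legendreP n).eval s : ℝ) : ℂ) := by
  unfold KN
  rw [Matrix.sum_apply]
  apply Finset.sum_congr rfl
  intro n _
  rw [Matrix.smul_apply, Kcoef_entry K n x hx hK, Complex.real_smul, mul_div_cancel_left₀ _ hx.ne']
  have : (x : ℂ) ≠ 0 := by exact_mod_cast hx.ne'
  push_cast
  field_simp

lemma KN_cont (K : ℝ → ℝ → M2) (N : ℕ) (x : ℝ) : Continuous (KN K N x) := by
  unfold KN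
  apply continuous_finsetSum
  intro n _
  have h : Continuous fun t : ℝ => x⁻¹ * (legendreP n).eval (t / x) :=
    continuous_const.mul ((legendreP n).continuous.comp (continuous_id.div_const x))
  exact h.smul continuous_const

lemma diff_eq_Lam (K : ℝ → ℝ → M2) (N : ℕ) (x : ℝ) (hx : 0 < x)
    (hK : ContinuousOn (K x) (Icc (-x) x)) (i l : Fin 2) (ν : ℂ) :
    (∫ t in (-x)..x, (K x t i l - KN K N x t i l) * Complex.exp (ν * t)) =
      x * Lam N (ν * x) (fun s => K x (x * s) i l) := by
  rw [scale_int]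
  congr 1
  have hmem : ∀ t ∈ Icc (-1 : ℝ) 1, x * t ∈ Icc (-x) x := by
    intro t ht
    constructor <;> nlinarith [ht.1, ht.2]
  have he : Continuous fun t : ℝ => Complex.exp (ν * x * t) := by fun_prop
  have hKc : ContinuousOn (fun s => K x (x * s) i l) (Icc (-1) 1) :=
    entry_contOn i l _ _ (hK.comp (by fun_prop) hmem)
  have e : ∀ s : ℝ, (K x (x * s) i l - KN K N x (x * s) i l) * Complex.exp (ν * ((x * s : ℝ) : ℂ)) =
      K x (x * s) i l * Complex.exp (ν * x * s) - ∑ n ∈ Finset.range (N + 1), ((2 * (n : ℂ) + 1) / 2) *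
      (∫ t in (-1 : ℝ)..1, ((((legendreP n).eval t : ℝ) : ℂ)) * K x (x * t) i l) *
      ((((legendreP n).eval s : ℝ) : ℂ) * Complex.exp (ν * x * s)) := by
    intro s
    rw [KN_entry K N x s hx hK, sub_mul, Finset.sum_mul]
    push_cast
    simp only [mul_assoc]
  simp only [e]
  rw [intervalIntegral.integral_sub, intervalIntegral.integral_finsetSum]
  · unfold Lam
    congr 1
    apply Finset.sum_congr rfl
    intro n _
    rw [intervalIntegral.integral_const_mul]
  · intro n _
    apply Continuous.intervalIntegrable
    exact continuous_const.mul ((legc_cont n).mul he)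
  · exact ii_of_contOn hKc he
  · apply Continuous.intervalIntegrable
    exact continuous_finsetSum _ fun n _ => continuous_const.mul ((legc_cont n).mul he)

lemma U0_entry (l j : Fin 2) : ∃ c d : ℂ, ‖c‖ ≤ 1 / 2 ∧ ‖d‖ ≤ 1 / 2 ∧ ∀ (lam : ℂ) (t : ℝ),
    U0 lam t l j = c * Complex.exp ((lam * Complex.I) * t) +
      d * Complex.exp (-(lam * Complex.I) * t) := by
  have e : ∀ (lam : ℂ) (t : ℝ), lam * Complex.I * t = lam * t * Complex.I := by intros; ring
  have e' : ∀ (lam : ℂ) (t : ℝ), -(lam * Complex.I) * t = -(lam * t) * Complex.I := by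
    intros; ring
  fin_cases l <;> fin_cases j
  · refine ⟨1 / 2, 1 / 2, by norm_num, by norm_num, fun lam t => ?_⟩
    rw [e, e']; simp [U0, Complex.cos]; ring
  · refine ⟨Complex.I / 2, -Complex.I / 2, by simp, by simp, fun lam t => ?_⟩
    rw [e, e']; simp [U0, Complex.sin]; ring
  · refine ⟨-Complex.I / 2, Complex.I / 2, by simp, by simp, fun lam t => ?_⟩
    rw [e, e']; simp [U0, Complex.sin]; ring
  · refine ⟨1 / 2, 1 / 2, by norm_num, by norm_num, fun lam t => ?_⟩
    rw [e, e']; simp [U0, Complex.cos]; ring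

lemma U0_cont (lam : ℂ) (l j : Fin 2) : Continuous fun t => U0 lam t l j := by
  obtain ⟨c, d, -, -, h⟩ := U0_entry l j
  simp only [h]
  fun_prop

lemma mul_U0_contOn (lam : ℂ) (f : ℝ → M2) (s : Set ℝ) (hf : ContinuousOn f s) :
    ContinuousOn (fun t => f t * U0 lam t) s := by
  apply contOn_of_entry
  intro i j
  simp only [Matrix.mul_apply, Fin.sum_univ_two]
  exact ((entry_contOn i 0 f s hf).mul (U0_cont lam 0 j).continuousOn).add
    ((entry_contOn i 1 f s hf).mul (U0_cont lam 1 j).continuousOn)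

lemma main_bound (p : ℕ) (K : ℝ → ℝ → M2) (x : ℝ) (hx : 0 < x) (M : ℝ)
    (hf : ContDiffOn ℝ (p + 1 : ℕ) (K x) (Icc (-x) x))
    (hm : ∀ t ∈ Icc (-x) x, opNorm (iteratedDerivWithin (p + 1) (K x) (Icc (-x) x) t) ≤ M)
    (N : ℕ) (hN : p + 1 < N) (lam : ℂ) :
    opNorm (Umat K lam x - UmatN K N lam x) ≤
      4 * (4 * (x * (Cst p N * Jint (lam.im * x) * (x ^ (p + 1) * M)))) := by
  have hK := hf.continuousOn
  set R := Cst p N * Jint (lam.im * x) * (x ^ (p + 1) * M) with hR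
  apply opNorm_le_entries
  intro i j
  have hKN : ContinuousOn (KN K N x) (Icc (-x) x) := (KN_cont K N x).continuousOn
  have i1 := mul_U0_contOn lam _ _ hK
  have i2 := mul_U0_contOn lam _ _ hKN
  have hii : ∀ {E : Type} [NormedAddCommGroup E] (g : ℝ → E), ContinuousOn g (Icc (-x) x) →
      IntervalIntegrable g volume (-x) x := by
    intro E _ g hg
    apply ContinuousOn.intervalIntegrable
    rwa [uIcc_of_le (by linarith)]
  have hd : ∀ l, ContinuousOn (fun t => K x t i l - KN K N x t i l) (Icc (-x) x) := fun l =>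
    (entry_contOn i l _ _ hK).sub (entry_contOn i l _ _ hKN)
  have e1 : (Umat K lam x - UmatN K N lam x) i j =
      (∫ t in (-x)..x, (K x t i 0 - KN K N x t i 0) * U0 lam t 0 j) +
      ∫ t in (-x)..x, (K x t i 1 - KN K N x t i 1) * U0 lam t 1 j := by
    unfold Umat UmatN
    rw [add_sub_add_left_eq_sub, Matrix.sub_apply, integral_entry i j _ _ _ (by linarith) i1,
      integral_entry i j _ _ _ (by linarith) i2, ← intervalIntegral.integral_sub
        (hii _ (entry_contOn i j _ _ i1)) (hii _ (entry_contOn i j _ _ i2)),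
      ← intervalIntegral.integral_add]
    · congr 1; ext t
      simp only [Matrix.mul_apply, Fin.sum_univ_two]
      ring
    · exact hii _ ((hd 0).mul (U0_cont lam 0 j).continuousOn)
    · exact hii _ ((hd 1).mul (U0_cont lam 1 j).continuousOn)
  have hb : ∀ (ν : ℂ) (l : Fin 2), (ν * x).re = lam.im * x ∨ (ν * x).re = -(lam.im * x) →
      ‖∫ t in (-x)..x, (K x t i l - KN K N x t i l) * Complex.exp (ν * t)‖ ≤ x * (2 * R) := by
    intro ν l hν
    rw [diff_eq_Lam K N x hx hK, norm_mul, Complex.norm_real, Real.norm_of_nonneg hx.le]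
    apply mul_le_mul_of_nonneg_left _ hx.le
    have := Lam_entry x hx M p (K x) hf hm N hN (ν * x) i l
    have hJ : Jint (ν * x).re = Jint (lam.im * x) := by
      rcases hν with h | h <;> rw [h]
      exact Jint_neg _
    rwa [hJ] at this
  have hl : ∀ l, ‖∫ t in (-x)..x, (K x t i l - KN K N x t i l) * U0 lam t l j‖ ≤ x * (2 * R) := by
    intro l
    obtain ⟨c, d, hc, hd', hU⟩ := U0_entry l j
    have hce : ∀ ν : ℂ, ContinuousOn (fun t : ℝ => Complex.exp (ν * t)) (Icc (-x) x) := by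
      intro ν; fun_prop
    have e2 : ∫ t in (-x)..x, (K x t i l - KN K N x t i l) * U0 lam t l j =
        c * (∫ t in (-x)..x, (K x t i l - KN K N x t i l) * Complex.exp ((lam * Complex.I) * t)) +
        d * (∫ t in (-x)..x, (K x t i l - KN K N x t i l) * Complex.exp (-(lam * Complex.I) * t)) := by
      rw [← intervalIntegral.integral_const_mul, ← intervalIntegral.integral_const_mul,
        ← intervalIntegral.integral_add]
      · congr 1; ext t
        rw [hU]; ring
      · exact hii _ (continuousOn_const.mul ((hd l).mul (hce _)))
      · exact hii _ (continuousOn_const.mul ((hd l).mul (hce _)))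
    rw [e2]
    refine (norm_add_le _ _).trans ?_
    rw [norm_mul, norm_mul]
    have b1 := hb (lam * Complex.I) l (by right; simp)
    have b2 := hb (-(lam * Complex.I)) l (by left; simp)
    have := mul_le_mul hc b1 (norm_nonneg _) (by norm_num)
    have := mul_le_mul hd' b2 (norm_nonneg _) (by norm_num)
    linarith
  rw [e1]
  refine (norm_add_le _ _).trans ?_
  have := hl 0
  have := hl 1
  linarith

/-- uniform (in `λ`) rate of convergence of the truncated NSBF representation. -/
theorem statement14 (p : ℕ) :
    ∃ C : ℝ, 0 < C ∧ ∀ b : ℝ, 0 < b → ∀ pf qf : ℝ → ℂ, ∀ K : ℝ → ℝ → M2,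
      ContDiffOn ℝ ((p : ℕ∞) + 1) (diracPot pf qf) (Set.Icc 0 b) →
      ContDiffOn ℝ ((p : ℕ∞) + 1) (fun z : ℝ × ℝ => K z.1 z.2) (OmegaPlus b) →
      IsTransKernel b (diracPot pf qf) K →
      ∀ M : ℝ,
        (∀ x t : ℝ, (x, t) ∈ OmegaPlus b →
          opNorm (iteratedDerivWithin (p + 1) (fun s => K x s) (Set.Icc (-x) x) t) ≤ M) →
        ∀ N : ℕ, p + 1 < N → ∀ x : ℝ, x ∈ Set.Ioc 0 b →
          (∀ lam : ℝ, opNorm (Umat K (lam : ℂ) x - UmatN K N (lam : ℂ) x)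
              ≤ 2 * C * M * x ^ (p + 2) / (N : ℝ) ^ ((p : ℝ) + 1 / 2)) ∧
          (∀ lam : ℂ, lam.im ≠ 0 → opNorm (Umat K lam x - UmatN K N lam x)
              ≤ 2 * C * M * (x ^ (p + 1) / (N : ℝ) ^ ((p : ℝ) + 1 / 2)) *
                ((Real.exp (|lam.im| * x) - 1) / |lam.im|)) := by
  refine ⟨16 * (15 * ((p : ℝ) + 2) ^ (p + 1)), by positivity, ?_⟩
  intro b hb pf qf K _ hK _ M hM N hN x hx
  have hx0 : 0 < x := hx.1
  have hmem : ∀ t ∈ Icc (-x) x, (x, t) ∈ OmegaPlus b := fun t ht =>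
    ⟨hx0.le, hx.2, abs_le.mpr ht⟩
  have hf : ContDiffOn ℝ (p + 1 : ℕ) (K x) (Icc (-x) x) := by
    have h1 : ContDiffOn ℝ ((p : ℕ∞) + 1) (fun t : ℝ => ((x, t) : ℝ × ℝ)) (Icc (-x) x) :=
      (contDiff_const.prodMk contDiff_id).contDiffOn
    have h2 := hK.comp h1 hmem
    exact_mod_cast h2
  have hm : ∀ t ∈ Icc (-x) x, opNorm (iteratedDerivWithin (p + 1) (K x) (Icc (-x) x) t) ≤ M :=
    fun t ht => hM x t (hmem t ht)
  have hM0 : 0 ≤ M := (norm_nonneg _).trans (hm 0 ⟨by linarith, hx0.le⟩)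
  have hmain := main_bound p K x hx0 M hf hm N hN
  constructor
  · intro lam
    refine (hmain lam).trans (le_of_eq ?_)
    rw [Complex.ofReal_im, zero_mul, Jint_zero]
    unfold Cst
    ring
  · intro lam hlam
    refine (hmain lam).trans ?_
    have ha : 0 < |lam.im| := abs_pos.mpr hlam
    have hJ : Jint (lam.im * x) ≤ 2 * ((Real.exp (|lam.im| * x) - 1) / (|lam.im| * x)) := by
      rw [← Jint_abs, abs_mul, abs_of_pos hx0]
      exact Jint_le _ (by positivity)
    have hC : 0 ≤ Cst p N := by unfold Cst; positivity
    calc _ ≤ 4 * (4 * (x * (Cst p N * (2 * ((Real.exp (|lam.im| * x) - 1) / (|lam.im| * x)))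
          * (x ^ (p + 1) * M)))) := by gcongr
      _ = _ := by
        unfold Cst
        field_simp
        ring

end
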